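/- For every integer n ≥ 1, the space Hom(ℤ², SL(n,ℂ))⁺/SL(n,ℂ) of conjugation classes of pairs of commuting semisimple elements of SL(n,ℂ) is homotopy equivalent to the complex projective space ℂP^{n-1}. -/

import Mathlib

open Matrix

/-- The space `Hom(ℤ^m, G)` of commuting `m`-tuples with entries in a subset `G`
of a monoid `M`, as a subset of `M^m` (with the subspace topology). -/
def commTuples {M : Type*} [Monoid M] (m : ℕ) (G : Set M) : Set (Fin m → M) :=
  {f | (∀ i, f i ∈ G) ∧ ∀ i j, f i * f j = f j * f i}

/-- Simultaneous conjugation, by elements of `G` (together with their inverses in `G`),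
of tuples lying in a subset `S` of `M^m`. -/
def conjRel {M : Type*} [Monoid M] {m : ℕ} (G : Set M) (S : Set (Fin m → M)) :
    S → S → Prop := fun x y =>
  ∃ g gi : M, g ∈ G ∧ gi ∈ G ∧ g * gi = 1 ∧ gi * g = 1 ∧
    ∀ i, g * (x : Fin m → M) i * gi = (y : Fin m → M) i

/-- The conjugation orbit space `S/G`, with the quotient topology. -/
abbrev RepSpace {M : Type*} [Monoid M] [TopologicalSpace M] {m : ℕ} (G : Set M)
    (S : Set (Fin m → M)) : Type _ := Quot (conjRel G S)

/-- `A` is a strong deformation retract of `X`. -/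
def IsStrongDeformationRetract {X : Type*} [TopologicalSpace X] (A : Set X) : Prop :=
  ∃ H : X × unitInterval → X, Continuous H ∧
    (∀ x, H (x, 0) = x) ∧ (∀ x, H (x, 1) ∈ A) ∧ (∀ a ∈ A, ∀ t, H (a, t) = a)

/-- A complex square matrix is semisimple if it is diagonalizable over `ℂ`. -/
def IsSemisimpleMat {n : ℕ} (A : Matrix (Fin n) (Fin n) ℂ) : Prop :=
  ∃ P Pi : Matrix (Fin n) (Fin n) ℂ, P * Pi = 1 ∧ Pi * P = 1 ∧ (Pi * A * P).IsDiag

/-- The subspace `Hom(ℤ^m, G)⁺` of commuting `m`-tuples in `G` all of whose entries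
are semisimple. -/
def ssTuples (m : ℕ) {n : ℕ} (G : Set (Matrix (Fin n) (Fin n) ℂ)) :
    Set (Fin m → Matrix (Fin n) (Fin n) ℂ) :=
  {f | f ∈ commTuples m G ∧ ∀ i, IsSemisimpleMat (f i)}

/-- `GL(n,ℂ)` as the set of invertible complex `n × n` matrices. -/
def GLset (n : ℕ) : Set (Matrix (Fin n) (Fin n) ℂ) := {A | IsUnit A}

/-- `U(n)` as a set of complex `n × n` matrices. -/
def Uset (n : ℕ) : Set (Matrix (Fin n) (Fin n) ℂ) := Matrix.unitaryGroup (Fin n) ℂ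

/-- `SL(n,ℂ)` as the set of complex `n × n` matrices of determinant one. -/
def SLset (n : ℕ) : Set (Matrix (Fin n) (Fin n) ℂ) := {A | A.det = 1}

/-- `SU(n)` as a set of complex `n × n` matrices. -/
def SUset (n : ℕ) : Set (Matrix (Fin n) (Fin n) ℂ) :=
  {A | A ∈ Matrix.unitaryGroup (Fin n) ℂ ∧ A.det = 1}

/-- The projectivization of `ℂ^k` (i.e. the complex projective space `ℂP^{k-1}`),
with its standard (quotient) topology. -/
noncomputable instance (k : ℕ) : TopologicalSpace (Projectivization ℂ (Fin k → ℂ)) := by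
  unfold Projectivization; infer_instance

namespace SquareTheta

open Complex Filter Topology

/-- The nome `e^{-2π}` of the square lattice. -/
noncomputable def nome : ℂ := cexp (-2 * Real.pi)

lemma norm_nome_lt_one : ‖nome‖ < 1 := by
  rw [nome, Complex.norm_exp]
  simp [Real.pi_pos]

lemma nome_ne_zero : nome ≠ 0 := Complex.exp_ne_zero _

/-- The infinite product `∏ (1 - q^k u)`, with `q` the nome of the square lattice. -/
noncomputable def qProd (u : ℂ) : ℂ := ∏' k : ℕ, (1 + -(nome ^ k * u))

lemma summable_nome_pow_mul (u : ℂ) : Summable fun k : ℕ ↦ ‖-(nome ^ k * u)‖ := by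
  simpa using (summable_geometric_of_lt_one (norm_nonneg _) norm_nome_lt_one).mul_right ‖u‖

lemma qProd_eq (u : ℂ) : qProd u = (1 - u) * qProd (nome * u) := by
  have h := (multipliable_one_add_of_summable (summable_nome_pow_mul (nome * u)))
  rw [qProd, tprod_eq_zero_mul']
  · simp only [pow_zero, one_mul, ← sub_eq_add_neg, qProd, pow_succ, mul_assoc]
  · simpa only [pow_succ, mul_assoc] using h

lemma qProd_ne_zero {u : ℂ} (hu : ∀ k : ℕ, nome ^ k * u ≠ 1) : qProd u ≠ 0 :=
  tprod_one_add_ne_zero_of_summable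
    (fun k h ↦ hu k (by linear_combination -h)) (summable_nome_pow_mul u)

lemma qProd_eq_zero_of_eq_one {k : ℕ} {u : ℂ} (h : nome ^ k * u = 1) : qProd u = 0 := by
  induction k generalizing u with
  | zero => rw [qProd_eq]; simp_all
  | succ k ih => rw [qProd_eq, ih (by rw [← h]; ring), mul_zero]

lemma differentiable_qProd : Differentiable ℂ qProd := by
  intro u
  have hlu : HasProdLocallyUniformlyOn (fun (k : ℕ) (u : ℂ) ↦ 1 + -(nome ^ k * u)) qProd
      (Metric.ball 0 (‖u‖ + 1)) := by
    refine Summable.hasProdLocallyUniformlyOn_nat_one_add Metric.isOpen_ball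
      (u := fun k ↦ ‖nome‖ ^ k * (‖u‖ + 1))
      ((summable_geometric_of_lt_one (norm_nonneg _) norm_nome_lt_one).mul_right _)
      (.of_forall fun k x hx ↦ ?_) (fun _ ↦ by fun_prop)
    rw [norm_neg, norm_mul, norm_pow]
    gcongr
    simpa using (mem_ball_zero_iff.1 hx).le
  refine (hlu.differentiableOn (.of_forall fun _ ↦ ?_) Metric.isOpen_ball).differentiableAt
    (Metric.isOpen_ball.mem_nhds (by simp))
  simpa [Finset.prod_fn] using DifferentiableOn.finsetProd (fun _ _ ↦ by fun_prop)

/-- The theta function of the square lattice `ℤ + ℤ i`, as an infinite product. -/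
noncomputable def theta (z : ℂ) : ℂ :=
  qProd (cexp (2 * Real.pi * I * z)) * qProd (nome * cexp (-(2 * Real.pi * I * z)))

/-- Entire functions `f` with `f (z + 1) = f z` and `f (z + i) = c e^{-2πinz} f z`. -/
structure IsThetaFun (n : ℕ) (c : ℂ) (f : ℂ → ℂ) : Prop where
  differentiable : Differentiable ℂ f
  add_one : ∀ z, f (z + 1) = f z
  add_I : ∀ z, f (z + I) = c * cexp (-(2 * Real.pi * I * (n * z))) * f z

lemma exp_two_pi_mul_add_one (z : ℂ) :
    cexp (2 * Real.pi * I * (z + 1)) = cexp (2 * Real.pi * I * z) := by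
  rw [mul_add, mul_one, Complex.exp_add, Complex.exp_two_pi_mul_I, mul_one]

lemma exp_two_pi_mul_add_I (z : ℂ) :
    cexp (2 * Real.pi * I * (z + I)) = nome * cexp (2 * Real.pi * I * z) := by
  rw [nome, ← Complex.exp_add]
  congr 1
  linear_combination (2 * Real.pi : ℂ) * I_mul_I

lemma isThetaFun_theta : IsThetaFun 1 (-1) theta where
  differentiable := by
    have := differentiable_qProd
    unfold theta
    fun_prop
  add_one z := by rw [theta, theta, Complex.exp_neg, exp_two_pi_mul_add_one, ← Complex.exp_neg]
  add_I z := by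
    rw [theta, theta, Complex.exp_neg, exp_two_pi_mul_add_I, Nat.cast_one, one_mul, Complex.exp_neg]
    set u := cexp (2 * Real.pi * I * z)
    have hu : u ≠ 0 := Complex.exp_ne_zero _
    have hq := nome_ne_zero
    have h1 : nome * (nome * u)⁻¹ = u⁻¹ := by field_simp
    rw [h1, qProd_eq u, qProd_eq u⁻¹]
    field_simp
    ring

/-- Membership in the square lattice `ℤ + ℤ i`. -/
def IsLattice (z : ℂ) : Prop := ∃ a b : ℤ, z = a + b * I

lemma theta_eq_zero_of_isLattice_zero : theta 0 = 0 := by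
  rw [theta, qProd_eq_zero_of_eq_one (k := 0) (by simp), zero_mul]

lemma exists_of_nome_zpow_mul_exp {k : ℤ} {z : ℂ}
    (h : nome ^ k * cexp (2 * Real.pi * I * z) = 1) : IsLattice z := by
  rw [nome, ← Complex.exp_int_mul, ← Complex.exp_add, Complex.exp_eq_one_iff] at h
  obtain ⟨m, hm⟩ := h
  refine ⟨m, -k, ?_⟩
  have h2 : (2 * Real.pi * I : ℂ) ≠ 0 := Complex.two_pi_I_ne_zero
  apply mul_left_cancel₀ h2
  push_cast
  linear_combination hm + 2 * Real.pi * k * I_mul_I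

lemma isLattice_of_theta_eq_zero {z : ℂ} (h : theta z = 0) : IsLattice z := by
  by_contra hz
  rw [theta, mul_eq_zero] at h
  rcases h with h | h
  · refine qProd_ne_zero (fun k hk ↦ hz ?_) h
    exact exists_of_nome_zpow_mul_exp (k := k) (by simpa using hk)
  · refine qProd_ne_zero (fun k hk ↦ hz ?_) h
    refine exists_of_nome_zpow_mul_exp (k := -(k + 1 : ℕ)) ?_
    rw [Complex.exp_neg, ← mul_assoc, ← pow_succ] at hk
    rw [_root_.zpow_neg, zpow_natCast]
    have := inv_inj.2 hk
    simpa [mul_inv, mul_comm] using this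

lemma deriv_theta_zero_ne : deriv theta 0 ≠ 0 := by
  set g : ℂ → ℂ := fun z ↦ qProd (nome * cexp (2 * Real.pi * I * z)) *
    qProd (nome * cexp (-(2 * Real.pi * I * z))) with hg
  have hgd : Differentiable ℂ g := by
    have := differentiable_qProd
    fun_prop
  have hq : qProd nome ≠ 0 := by
    refine qProd_ne_zero fun k hk ↦ ?_
    have h1 : ‖nome ^ k * nome‖ < 1 := by
      rw [← pow_succ, norm_pow]
      exact pow_lt_one₀ (norm_nonneg _) norm_nome_lt_one (by simp)
    rw [hk] at h1
    simp at h1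
  have hth : theta = fun z ↦ (1 - cexp (2 * Real.pi * I * z)) * g z := by
    ext z
    rw [theta, qProd_eq, hg, mul_assoc]
  have h1 : HasDerivAt (fun z : ℂ ↦ 1 - cexp (2 * Real.pi * I * z))
      (-(cexp (2 * Real.pi * I * 0) * (2 * Real.pi * I * 1))) 0 :=
    (((hasDerivAt_id (0 : ℂ)).const_mul (2 * Real.pi * I)).cexp).const_sub 1
  have h2 := h1.mul (hgd 0).hasDerivAt
  have h3 : deriv theta 0 = -(2 * Real.pi * I) * (qProd nome * qProd nome) := by
    rw [hth]
    refine h2.deriv.trans ?_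
    simp [hg]
  rw [h3]
  exact mul_ne_zero (neg_ne_zero.2 Complex.two_pi_I_ne_zero) (mul_ne_zero hq hq)

namespace IsThetaFun

variable {n m : ℕ} {c d : ℂ} {f g : ℂ → ℂ}

lemma mul (hf : IsThetaFun n c f) (hg : IsThetaFun m d g) :
    IsThetaFun (n + m) (c * d) (fun z ↦ f z * g z) where
  differentiable := hf.differentiable.mul hg.differentiable
  add_one z := by rw [hf.add_one, hg.add_one]
  add_I z := by
    rw [hf.add_I, hg.add_I]
    push_cast
    rw [add_mul, mul_add, neg_add, Complex.exp_add]
    ring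

lemma comp_sub (hf : IsThetaFun n c f) (w : ℂ) :
    IsThetaFun n (c * cexp (2 * Real.pi * I * (n * w))) (fun z ↦ f (z - w)) where
  differentiable := by
    have := hf.differentiable
    fun_prop
  add_one z := by rw [add_sub_right_comm, hf.add_one]
  add_I z := by
    rw [add_sub_right_comm, hf.add_I, mul_assoc c (cexp _) (cexp _), ← Complex.exp_add]
    congr 3
    ring

lemma add_smul (hf : IsThetaFun n c f) (hg : IsThetaFun n c g) (a b : ℂ) :
    IsThetaFun n c (fun z ↦ a * f z + b * g z) where
  differentiable := (hf.differentiable.const_mul a).add (hg.differentiable.const_mul b)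
  add_one z := by rw [hf.add_one, hg.add_one]
  add_I z := by rw [hf.add_I, hg.add_I]; ring

lemma sum {ι : Type*} (s : Finset ι) {F : ι → ℂ → ℂ} (a : ι → ℂ)
    (hF : ∀ i ∈ s, IsThetaFun n c (F i)) : IsThetaFun n c (fun z ↦ ∑ i ∈ s, a i * F i z) where
  differentiable := by
    refine Differentiable.fun_sum fun i hi ↦ (hF i hi).differentiable.const_mul _
  add_one z := Finset.sum_congr rfl fun i hi ↦ by rw [(hF i hi).add_one]
  add_I z := by
    rw [Finset.mul_sum]
    exact Finset.sum_congr rfl fun i hi ↦ by rw [(hF i hi).add_I]; ring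

lemma add_int (hf : IsThetaFun n c f) (a : ℤ) (z : ℂ) : f (z + a) = f z := by
  have : Function.Periodic f 1 := hf.add_one
  simpa using this.int_mul a z

lemma exists_add_int_mul_I (hf : IsThetaFun n c f) (hc : c ≠ 0) (b : ℤ) :
    ∃ e : ℂ, e ≠ 0 ∧ ∀ z, f (z + b * I) = e * cexp (-(2 * Real.pi * I * (n * b * z))) * f z := by
  induction b with
  | zero => exact ⟨1, one_ne_zero, fun z ↦ by simp⟩
  | succ b ih =>
    obtain ⟨e, he, h⟩ := ih
    refine ⟨e * c * cexp (-(2 * Real.pi * I * (n * (b * I)))), by simp [he, hc], fun z ↦ ?_⟩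
    have h1 : z + ((b : ℤ) + 1 : ℤ) * I = z + (b : ℤ) * I + I := by push_cast; ring
    rw [h1, hf.add_I, h]
    have h2 : cexp (-(2 * Real.pi * I * (n * ((b : ℤ) + 1 : ℤ) * z))) =
      cexp (-(2 * Real.pi * I * (n * (b : ℤ) * z))) * cexp (-(2 * Real.pi * I * (n * z))) := by
      rw [← Complex.exp_add]; congr 1; push_cast; ring
    have h3 : cexp (-(2 * Real.pi * I * (n * (z + (b : ℤ) * I)))) =
      cexp (-(2 * Real.pi * I * (n * (b * I)))) * cexp (-(2 * Real.pi * I * (n * z))) := by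
      rw [← Complex.exp_add]; congr 1; push_cast; ring
    rw [h2, h3]; ring
  | pred b ih =>
    obtain ⟨e, he, h⟩ := ih
    refine ⟨e * c⁻¹ * cexp (2 * Real.pi * I * (n * ((-b - 1) * I))), by simp [he, hc],
      fun z ↦ ?_⟩
    have h1 := hf.add_I (z + (-(b : ℤ) - 1 : ℤ) * I)
    have h0 : z + (-(b : ℤ) - 1 : ℤ) * I + I = z + (-(b : ℤ) : ℤ) * I := by push_cast; ring
    rw [h0, h] at h1
    have h2 : cexp (-(2 * Real.pi * I * (n * (-(b : ℤ) : ℤ) * z))) =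
        cexp (-(2 * Real.pi * I * (n * (-(b : ℤ) - 1 : ℤ) * z))) *
          cexp (-(2 * Real.pi * I * (n * z))) := by
      rw [← Complex.exp_add]; congr 1; push_cast; ring
    have h3 : cexp (-(2 * Real.pi * I * (n * (z + (-(b : ℤ) - 1 : ℤ) * I)))) =
      (cexp (2 * Real.pi * I * (n * ((-b - 1) * I))))⁻¹ * cexp (-(2 * Real.pi * I * (n * z))) := by
      rw [← Complex.exp_neg, ← Complex.exp_add]; congr 1; push_cast; ring
    rw [h2, h3] at h1
    have h4 := Complex.exp_ne_zero (2 * Real.pi * I * (n * ((-b - 1) * I)))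
    have h5 := Complex.exp_ne_zero (-(2 * Real.pi * I * (n * z)))
    field_simp at h1 ⊢
    linear_combination -h1

lemma exists_add_lattice (hf : IsThetaFun n c f) (hc : c ≠ 0) (a b : ℤ) :
    ∃ e : ℂ, e ≠ 0 ∧
      ∀ z, f (z + (a + b * I)) = e * cexp (-(2 * Real.pi * I * (n * b * z))) * f z := by
  obtain ⟨e, he, h⟩ := hf.exists_add_int_mul_I hc b
  refine ⟨e, he, fun z ↦ ?_⟩
  rw [add_left_comm, add_comm, hf.add_int, h]

lemma eq_zero_add_lattice (hf : IsThetaFun n c f) (hc : c ≠ 0) {w l : ℂ} (hl : IsLattice l)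
    (hw : f w = 0) : f (w + l) = 0 := by
  obtain ⟨a, b, rfl⟩ := hl
  obtain ⟨e, -, h⟩ := hf.exists_add_lattice hc a b
  rw [h, hw, mul_zero]

end IsThetaFun

lemma theta_eq_zero_iff {z : ℂ} : theta z = 0 ↔ IsLattice z := by
  refine ⟨isLattice_of_theta_eq_zero, fun h ↦ ?_⟩
  simpa using isThetaFun_theta.eq_zero_add_lattice (by simp) h theta_eq_zero_of_isLattice_zero

lemma deriv_theta_ne_zero {l : ℂ} (hl : IsLattice l) : deriv theta l ≠ 0 := by
  obtain ⟨a, b, rfl⟩ := hl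
  obtain ⟨e, he, h⟩ := isThetaFun_theta.exists_add_lattice (by simp) a b
  have h1 : deriv (fun z ↦ theta (z + (a + b * I))) 0 = deriv theta (a + b * I) := by
    rw [deriv_comp_add_const, zero_add]
  have h2 : HasDerivAt (fun z : ℂ ↦ e * cexp (-(2 * Real.pi * I * ((1 : ℕ) * b * z))) * theta z)
      (deriv (fun z : ℂ ↦ e * cexp (-(2 * Real.pi * I * ((1 : ℕ) * b * z)))) 0 * theta 0 +
        e * cexp (-(2 * Real.pi * I * ((1 : ℕ) * b * 0))) * deriv theta 0) 0 := by
    refine HasDerivAt.mul (DifferentiableAt.hasDerivAt (by fun_prop))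
      (isThetaFun_theta.differentiable 0).hasDerivAt
  rw [← h1, funext h, h2.deriv, theta_eq_zero_of_isLattice_zero]
  simpa using ⟨he, deriv_theta_zero_ne⟩

lemma theta_ne_zero_fun : ∃ z, theta z ≠ 0 := by
  by_contra! h
  exact deriv_theta_zero_ne (by rw [funext h]; simp)

lemma exists_theta_sub_ne_zero (w : ℂ) : ∃ z, theta (z - w) ≠ 0 := by
  obtain ⟨z, hz⟩ := theta_ne_zero_fun
  exact ⟨z + w, by simpa using hz⟩

/-- Entire functions that agree after multiplication by a nonzero entire function are equal. -/
lemma eq_of_mul_eq_mul {f g h : ℂ → ℂ} (hf : Differentiable ℂ f) (hg : Differentiable ℂ g)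
    (hh : Differentiable ℂ h) (h0 : ∃ z, h z ≠ 0) (hfg : ∀ z, f z * h z = g z * h z) (z : ℂ) :
    f z = g z := by
  have key := AnalyticOnNhd.eq_zero_or_eq_zero_of_mul_eq_zero (U := Set.univ)
    (f := fun z ↦ f z - g z) (g := h)
    ((hf.sub hg).differentiableOn.analyticOnNhd isOpen_univ)
    (hh.differentiableOn.analyticOnNhd isOpen_univ)
    (fun z _ ↦ by rw [sub_mul, hfg, sub_self]) isPreconnected_univ
  rcases key with key | key
  · exact sub_eq_zero.1 (key z trivial)
  · obtain ⟨z, hz⟩ := h0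
    exact absurd (key z trivial) hz

/-- A quotient of entire functions is entire if the numerator vanishes at the zeros of the
denominator, which are all simple. -/
lemma exists_differentiable_mul_eq {f g : ℂ → ℂ} (hf : Differentiable ℂ f)
    (hg : Differentiable ℂ g) (hfg : ∀ z, g z = 0 → f z = 0)
    (hg' : ∀ z, g z = 0 → deriv g z ≠ 0) :
    ∃ h : ℂ → ℂ, Differentiable ℂ h ∧ ∀ z, f z = h z * g z := by
  classical
  refine ⟨fun z ↦ if g z = 0 then deriv f z / deriv g z else f z / g z, fun w ↦ ?_, fun z ↦ ?_⟩
  · by_cases hw : g w = 0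
    · have hds : ∀ {k : ℂ → ℂ}, Differentiable ℂ k → DifferentiableAt ℂ (dslope k w) w :=
        fun hk ↦ ((differentiableOn_dslope (s := Set.univ) Filter.univ_mem).2
          hk.differentiableOn).differentiableAt Filter.univ_mem
      have hne : dslope g w w ≠ 0 := by simpa using hg' w hw
      refine ((hds hf).div (hds hg) hne).congr_of_eventuallyEq ?_
      filter_upwards [(hds hg).continuousAt.eventually_ne hne] with z hz
      have hmul : ∀ k : ℂ → ℂ, k w = 0 → k z = (z - w) * dslope k w z := fun k hk ↦ by
        have := sub_smul_dslope k w z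
        rw [hk, sub_zero, smul_eq_mul] at this
        exact this.symm
      rcases eq_or_ne z w with rfl | hzw
      · simp [hw]
      · have hzw' := sub_ne_zero.2 hzw
        have hgz : g z ≠ 0 := by
          rw [hmul g hw]
          exact mul_ne_zero hzw' hz
        rw [if_neg hgz, hmul g hw, hmul f (hfg w hw), Pi.div_apply]
        field_simp
    · refine ((hf w).div (hg w) hw).congr_of_eventuallyEq ?_
      filter_upwards [(hg w).continuousAt.eventually_ne hw] with z hz
      simp [hz]
  · by_cases hz : g z = 0
    · simp [hz, hfg z hz]
    · simp [hz]

lemma IsThetaFun.exists_mul_theta {n : ℕ} {c w : ℂ} {f : ℂ → ℂ} (hf : IsThetaFun (n + 1) c f)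
    (hc : c ≠ 0) (hw : f w = 0) :
    ∃ d g, d ≠ 0 ∧ IsThetaFun n d g ∧ ∀ z, f z = g z * theta (z - w) := by
  have hth := isThetaFun_theta.comp_sub w
  obtain ⟨g, hg, hfg⟩ := exists_differentiable_mul_eq hf.differentiable hth.differentiable
    (fun z hz ↦ by
      simpa using hf.eq_zero_add_lattice hc (theta_eq_zero_iff.1 hz) hw)
    (fun z hz ↦ by
      rw [deriv_comp_sub_const]
      exact deriv_theta_ne_zero (theta_eq_zero_iff.1 hz))
  have hE : cexp (2 * Real.pi * I * ((1 : ℕ) * w)) ≠ 0 := Complex.exp_ne_zero _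
  refine ⟨-c / cexp (2 * Real.pi * I * ((1 : ℕ) * w)), g, by simp [hc, Complex.exp_ne_zero],
    ⟨hg, ?_, ?_⟩, hfg⟩
  · refine eq_of_mul_eq_mul (f := fun z ↦ g (z + 1)) (by fun_prop) hg hth.differentiable
      (exists_theta_sub_ne_zero w) fun z ↦ ?_
    rw [← hfg, ← hf.add_one, hfg, ← hth.add_one]
  · refine eq_of_mul_eq_mul (f := fun z ↦ g (z + I))
      (g := fun z ↦ -c / cexp (2 * Real.pi * I * ((1 : ℕ) * w)) *
        cexp (-(2 * Real.pi * I * (n * z))) * g z) (by fun_prop) (by fun_prop) hth.differentiable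
      (exists_theta_sub_ne_zero w) fun z ↦ ?_
    have h1 := hfg (z + I)
    have h2 := hth.add_I z
    rw [hf.add_I, h2, hfg z] at h1
    have h3 : cexp (-(2 * Real.pi * I * ((n + 1 : ℕ) * z))) =
        cexp (-(2 * Real.pi * I * (n * z))) * cexp (-(2 * Real.pi * I * ((1 : ℕ) * z))) := by
      rw [← Complex.exp_add]; congr 1; push_cast; ring
    rw [h3] at h1
    have h4 := Complex.exp_ne_zero (-(2 * Real.pi * I * ((1 : ℕ) * z)))
    field_simp at h1 ⊢
    linear_combination h1

lemma exists_int_add_mem_square (z : ℂ) :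
    ∃ a b : ℤ, z + (a + b * I) ∈ Set.Icc (0 : ℝ) 1 ×ℂ Set.Icc (0 : ℝ) 1 := by
  refine ⟨-⌊z.re⌋, -⌊z.im⌋, ?_⟩
  rw [Complex.mem_reProdIm]
  have h1 := Int.floor_le z.re
  have h2 := (Int.lt_floor_add_one z.re).le
  have h3 := Int.floor_le z.im
  have h4 := (Int.lt_floor_add_one z.im).le
  constructor <;> constructor <;> simp <;> linarith

/-- An entire function whose modulus is doubly periodic is constant. -/
lemma exists_eq_const_of_norm_periodic {f : ℂ → ℂ} (hf : Differentiable ℂ f)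
    (h1 : ∀ z, ‖f (z + 1)‖ = ‖f z‖) (hI : ∀ z, ‖f (z + I)‖ = ‖f z‖) : ∃ a, ∀ z, f z = a := by
  have hK : IsCompact (Set.Icc (0 : ℝ) 1 ×ℂ Set.Icc (0 : ℝ) 1) :=
    isCompact_Icc.reProdIm isCompact_Icc
  obtain ⟨C, hC⟩ := hK.exists_bound_of_continuousOn hf.continuous.continuousOn
  have hper : ∀ (a b : ℤ) z, ‖f (z + (a + b * I))‖ = ‖f z‖ := fun a b z ↦ by
    have p1 : Function.Periodic (fun z ↦ ‖f z‖) 1 := h1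
    have p2 : Function.Periodic (fun z ↦ ‖f z‖) I := hI
    have e1 := p1.int_mul a (z + b * I)
    have e2 := p2.int_mul b z
    simp only [mul_one] at e1
    rw [add_left_comm, add_comm, e1, e2]
  refine hf.exists_eq_const_of_bounded (isBounded_iff_forall_norm_le.2 ⟨C, ?_⟩) |>.imp
    fun a ha z ↦ congrFun ha z
  rintro _ ⟨z, rfl⟩
  obtain ⟨a, b, hab⟩ := exists_int_add_mem_square z
  rw [← hper a b]
  exact hC _ hab

lemma IsThetaFun.exists_eq_exp {c : ℂ} {f : ℂ → ℂ} (hf : IsThetaFun 0 c f) (hc : c ≠ 0)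
    (h0 : ∃ z, f z ≠ 0) :
    ∃ a : ℂ, a ≠ 0 ∧ ∃ k : ℤ, ∀ z, f z = a * cexp (2 * Real.pi * I * (k * z)) := by
  have hI : ∀ z, f (z + I) = c * f z := fun z ↦ by simpa using hf.add_I z
  set β : ℂ := Real.log ‖c‖ * I with hβ
  obtain ⟨a, ha⟩ := exists_eq_const_of_norm_periodic (f := fun z ↦ f z * cexp (β * z))
    (by have := hf.differentiable; fun_prop)
    (fun z ↦ by
      rw [hf.add_one, norm_mul, norm_mul, Complex.norm_exp, Complex.norm_exp]
      simp [hβ])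
    (fun z ↦ by
      rw [hI, norm_mul, norm_mul, norm_mul, Complex.norm_exp, Complex.norm_exp]
      have h1 : (β * (z + I)).re = (β * z).re + - Real.log ‖c‖ := by
        simp [hβ]; ring
      have h2 : Real.exp (Real.log ‖c‖) = ‖c‖ := Real.exp_log (norm_pos_iff.2 hc)
      have h3 : ‖c‖ ≠ 0 := norm_ne_zero_iff.2 hc
      rw [h1, Real.exp_add, Real.exp_neg, h2]
      field_simp)
  have hfz : ∀ z, f z = a * cexp (-(β * z)) := fun z ↦ by
    rw [← ha z, mul_assoc, ← Complex.exp_add, add_neg_cancel, Complex.exp_zero, mul_one]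
  have ha0 : a ≠ 0 := by
    rintro rfl
    obtain ⟨z, hz⟩ := h0
    simp [hfz] at hz
  have hper := hf.add_one 0
  rw [hfz, hfz, zero_add, mul_zero, neg_zero, Complex.exp_zero] at hper
  obtain ⟨k, hk⟩ := Complex.exp_eq_one_iff.1 (mul_left_cancel₀ ha0 hper)
  refine ⟨a, ha0, k, fun z ↦ ?_⟩
  rw [hfz]
  congr 2
  linear_combination z * hk

lemma IsThetaFun.exists_eq_zero {n : ℕ} {c : ℂ} {f : ℂ → ℂ} (hf : IsThetaFun (n + 1) c f)
    (hc : c ≠ 0) : ∃ z, f z = 0 := by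
  by_contra! h
  have hfd := hf.differentiable
  have hfd' : Differentiable ℂ (deriv f) := fun z ↦
    ((hfd.analyticAt z).deriv).differentiableAt
  set φ : ℂ → ℂ := fun z ↦ deriv f z / f z with hφ
  have hφd : Differentiable ℂ φ := hfd'.div hfd h
  have hφ1 : ∀ z, φ (z + 1) = φ z := fun z ↦ by
    have : deriv f (z + 1) = deriv f z := by
      rw [← deriv_comp_add_const, funext hf.add_one]
    simp only [hφ, this, hf.add_one]
  have hφI : ∀ z, φ (z + I) = φ z - 2 * Real.pi * I * (n + 1) := fun z ↦ by
    have e1 : HasDerivAt (fun z : ℂ ↦ -(2 * Real.pi * I * ((n + 1 : ℕ) * z)))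
        (-(2 * Real.pi * I * ((n + 1 : ℕ) * 1))) z :=
      (((hasDerivAt_id z).const_mul _).const_mul _).neg
    have e2 := (e1.cexp.const_mul c).mul (hfd z).hasDerivAt
    have e3 := (deriv_comp_add_const f I z).symm.trans
      ((congrArg (deriv · z) (funext hf.add_I)).trans e2.deriv)
    have hz := h z
    have hE := Complex.exp_ne_zero (-(2 * Real.pi * I * ((n + 1 : ℕ) * z)))
    simp only [hφ, e3, hf.add_I]
    push_cast at hE ⊢
    field_simp
    ring
  have hφ'd : Differentiable ℂ (deriv φ) := fun z ↦
    ((hφd.analyticAt z).deriv).differentiableAt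
  obtain ⟨α, hα⟩ := exists_eq_const_of_norm_periodic hφ'd
    (fun z ↦ by rw [← deriv_comp_add_const, funext hφ1])
    (fun z ↦ by rw [← deriv_comp_add_const, funext hφI, deriv_sub_const])
  have hlin : ∀ z, φ z = φ 0 + α * z := fun z ↦ by
    have hd : Differentiable ℂ fun z ↦ φ z - α * z := by fun_prop
    have := is_const_of_deriv_eq_zero hd (fun z ↦ by
      refine ((hφd z).hasDerivAt.sub ((hasDerivAt_id z).const_mul α)).deriv.trans ?_
      rw [hα, mul_one, sub_self]) z 0
    linear_combination this
  have hα0 : α = 0 := by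
    have := hφ1 0
    rw [zero_add, hlin 1] at this
    linear_combination this
  have := hφI 0
  rw [zero_add, hlin I, hα0] at this
  have h2 : (2 * Real.pi * I : ℂ) * (n + 1) = 0 := by linear_combination this
  exact mul_ne_zero Complex.two_pi_I_ne_zero (Nat.cast_add_one_ne_zero n) h2

/-- The product of the translated theta functions with prescribed zeros. -/
noncomputable def thetaProd (M : Multiset ℂ) (z : ℂ) : ℂ := (M.map fun w ↦ theta (z - w)).prod

/-- A nonzero theta function is a product of translated theta functions, up to a unit. -/
lemma IsThetaFun.exists_factorization {n : ℕ} : ∀ {c : ℂ} {f : ℂ → ℂ}, IsThetaFun n c f → c ≠ 0 →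
    (∃ z, f z ≠ 0) → ∃ a : ℂ, a ≠ 0 ∧ ∃ k : ℤ, ∃ M : Multiset ℂ, M.card = n ∧
      ∀ z, f z = a * cexp (2 * Real.pi * I * (k * z)) * thetaProd M z := by
  induction n with
  | zero =>
    intro c f hf hc h0
    obtain ⟨a, ha, k, h⟩ := hf.exists_eq_exp hc h0
    exact ⟨a, ha, k, 0, rfl, fun z ↦ by simp [thetaProd, h]⟩
  | succ n ih =>
    intro c f hf hc h0
    obtain ⟨w, hw⟩ := hf.exists_eq_zero hc
    obtain ⟨d, g, hd, hg, hfg⟩ := hf.exists_mul_theta hc hw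
    obtain ⟨a, ha, k, M, hM, h⟩ := ih hg hd (by
      obtain ⟨z, hz⟩ := h0
      exact ⟨z, fun h ↦ hz (by rw [hfg, h, zero_mul])⟩)
    refine ⟨a, ha, k, w ::ₘ M, by simp [hM], fun z ↦ ?_⟩
    rw [hfg, h, thetaProd, thetaProd, Multiset.map_cons, Multiset.prod_cons]
    ring

/-- The isomorphism of `ℂ / (ℤ + ℤ i)` with the compact torus, as a map on `ℂ`. -/
noncomputable def latticeExp (z : ℂ) : ℂ × ℂ :=
  (cexp (2 * Real.pi * I * z.re), cexp (2 * Real.pi * I * z.im))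

lemma continuous_latticeExp : Continuous latticeExp := by
  unfold latticeExp
  fun_prop

lemma exp_two_pi_mul_eq_iff {x y : ℝ} :
    cexp (2 * Real.pi * I * x) = cexp (2 * Real.pi * I * y) ↔ ∃ k : ℤ, x - y = k := by
  rw [Complex.exp_eq_exp_iff_exists_int]
  refine exists_congr fun k ↦ ⟨fun h ↦ ?_, fun h ↦ ?_⟩
  · have h2 : (x : ℂ) = y + k := by
      apply mul_left_cancel₀ Complex.two_pi_I_ne_zero
      linear_combination h
    have h3 : x = y + k := by exact_mod_cast h2
    linarith
  · have h2 : (x : ℂ) = y + k := by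
      have h3 : x = y + k := by linarith
      exact_mod_cast h3
    rw [h2]
    ring

lemma latticeExp_eq_iff {z w : ℂ} : latticeExp z = latticeExp w ↔ IsLattice (z - w) := by
  rw [latticeExp, latticeExp, Prod.mk.injEq, exp_two_pi_mul_eq_iff, exp_two_pi_mul_eq_iff]
  constructor
  · rintro ⟨⟨a, ha⟩, b, hb⟩
    exact ⟨a, b, Complex.ext (by simpa using ha) (by simpa using hb)⟩
  · rintro ⟨a, b, h⟩
    exact ⟨⟨a, by simpa using congrArg Complex.re h⟩, b, by simpa using congrArg Complex.im h⟩

@[simp] lemma thetaProd_cons (w : ℂ) (M : Multiset ℂ) (z : ℂ) :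
    thetaProd (w ::ₘ M) z = theta (z - w) * thetaProd M z := by
  simp [thetaProd]

@[simp] lemma thetaProd_zero (z : ℂ) : thetaProd 0 z = 1 := by simp [thetaProd]

lemma isThetaFun_thetaProd (M : Multiset ℂ) :
    IsThetaFun M.card ((-1) ^ M.card * cexp (2 * Real.pi * I * M.sum)) (thetaProd M) := by
  induction M using Multiset.induction with
  | empty => exact ⟨by unfold thetaProd; simp, by simp, by simp⟩
  | cons w M ih =>
    have := (isThetaFun_theta.comp_sub w).mul ih
    rw [Multiset.card_cons, Multiset.sum_cons, add_comm]
    convert this using 1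
    · rw [mul_add, Complex.exp_add, Nat.cast_one, one_mul, pow_add]
      ring
    · ext z; simp

lemma thetaProd_eq_zero_iff {M : Multiset ℂ} {z : ℂ} :
    thetaProd M z = 0 ↔ latticeExp z ∈ M.map latticeExp := by
  induction M using Multiset.induction with
  | empty => simp
  | cons w M ih => simp [ih, theta_eq_zero_iff, ← latticeExp_eq_iff]

lemma exists_thetaProd_ne_zero (M : Multiset ℂ) : ∃ z, thetaProd M z ≠ 0 := by
  induction M using Multiset.induction with
  | empty => exact ⟨0, by simp⟩
  | cons w M ih =>
    by_contra! h
    obtain ⟨z, hz⟩ := ih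
    refine hz (eq_of_mul_eq_mul (g := 0) (isThetaFun_thetaProd M).differentiable
      (differentiable_const 0) (isThetaFun_theta.comp_sub w).differentiable
      (exists_theta_sub_ne_zero w) (fun z ↦ ?_) z)
    have := h z
    rw [thetaProd_cons] at this
    simpa [mul_comm] using this

lemma exists_theta_sub_eq {w w' : ℂ} (h : latticeExp w = latticeExp w') :
    ∃ a : ℂ, a ≠ 0 ∧ ∃ k : ℤ, ∀ z, theta (z - w) =
      a * cexp (2 * Real.pi * I * (k * z)) * theta (z - w') := by
  obtain ⟨a, b, hab⟩ := latticeExp_eq_iff.1 h.symm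
  obtain ⟨e, he, h⟩ := isThetaFun_theta.exists_add_lattice (by simp) a b
  refine ⟨e * cexp (2 * Real.pi * I * (b * w')), by simp [he], -b, fun z ↦ ?_⟩
  have h1 : z - w = z - w' + (a + b * I) := by linear_combination hab
  rw [h1, h, mul_assoc e (cexp _) (cexp _), ← Complex.exp_add]
  congr 3
  push_cast
  ring

/-- Products of theta functions with the same zeros modulo the lattice agree up to a unit. -/
lemma exists_thetaProd_eq {M : Multiset ℂ} : ∀ {M' : Multiset ℂ},
    M.map latticeExp = M'.map latticeExp → ∃ a : ℂ, a ≠ 0 ∧ ∃ k : ℤ, ∀ z,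
      thetaProd M z = a * cexp (2 * Real.pi * I * (k * z)) * thetaProd M' z := by
  induction M using Multiset.induction with
  | empty =>
    intro M' h
    obtain rfl : M' = 0 := by simpa using h.symm
    exact ⟨1, one_ne_zero, 0, by simp⟩
  | cons w M ih =>
    intro M' h
    have hw : latticeExp w ∈ M'.map latticeExp := by rw [← h]; simp
    obtain ⟨w', hw', hww⟩ := Multiset.mem_map.1 hw
    obtain ⟨M', rfl⟩ := Multiset.exists_cons_of_mem hw'
    rw [Multiset.map_cons, Multiset.map_cons, hww, Multiset.cons_inj_right] at h
    obtain ⟨a, ha, k, h1⟩ := ih h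
    obtain ⟨b, hb, l, h2⟩ := exists_theta_sub_eq hww.symm
    refine ⟨a * b, mul_ne_zero ha hb, k + l, fun z ↦ ?_⟩
    rw [thetaProd_cons, thetaProd_cons, h1, h2]
    push_cast
    rw [add_mul, mul_add, Complex.exp_add]
    ring

/-- Products of theta functions that agree up to a unit have the same zeros modulo the lattice. -/
lemma map_latticeExp_eq {M : Multiset ℂ} : ∀ {M' : Multiset ℂ} {a : ℂ}, a ≠ 0 → ∀ {k : ℤ},
    (∀ z, thetaProd M z = a * cexp (2 * Real.pi * I * (k * z)) * thetaProd M' z) →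
      M.map latticeExp = M'.map latticeExp := by
  induction M using Multiset.induction with
  | empty =>
    intro M' a ha k h
    rcases Multiset.empty_or_exists_mem M' with rfl | ⟨w, hw⟩
    · rfl
    · have h1 := h w
      rw [thetaProd_eq_zero_iff.2 (Multiset.mem_map_of_mem _ hw)] at h1
      simp at h1
  | cons w M ih =>
    intro M' a ha k h
    have h1 : thetaProd M' w = 0 := by
      have := h w
      rw [thetaProd_eq_zero_iff.2 (by simp)] at this
      simpa [ha] using this.symm
    obtain ⟨w', hw', hww⟩ := Multiset.mem_map.1 (thetaProd_eq_zero_iff.1 h1)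
    obtain ⟨M', rfl⟩ := Multiset.exists_cons_of_mem hw'
    obtain ⟨b, hb, l, h2⟩ := exists_theta_sub_eq hww
    rw [Multiset.map_cons, Multiset.map_cons, hww]
    congr 1
    have d1 := (isThetaFun_thetaProd M).differentiable
    have d2 := (isThetaFun_thetaProd M').differentiable
    refine ih (mul_ne_zero ha hb) (k := k + l) (eq_of_mul_eq_mul d1
      (g := fun z ↦ a * b * cexp (2 * Real.pi * I * ((k + l : ℤ) * z)) * thetaProd M' z)
      (by fun_prop)
      (isThetaFun_theta.comp_sub w).differentiable (exists_theta_sub_ne_zero w) fun z ↦ ?_)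
    have h3 := h z
    rw [thetaProd_cons, thetaProd_cons, h2] at h3
    push_cast
    rw [add_mul, mul_add, Complex.exp_add]
    linear_combination h3

lemma IsThetaFun.factor_eq_mul {n : ℕ} {c d a : ℂ} {k : ℤ} {f g : ℂ → ℂ} (hf : IsThetaFun n c f)
    (hg : IsThetaFun n d g) (h0 : ∃ z, f z ≠ 0)
    (h : ∀ z, f z = a * cexp (2 * Real.pi * I * (k * z)) * g z) :
    c = d * cexp (2 * Real.pi * I * (k * I)) := by
  obtain ⟨z, hz⟩ := h0
  have h1 := hf.add_I z
  have h2 : cexp (2 * Real.pi * I * (k * (z + I))) =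
      cexp (2 * Real.pi * I * (k * z)) * cexp (2 * Real.pi * I * (k * I)) := by
    rw [← Complex.exp_add]; congr 1; ring
  have hE := Complex.exp_ne_zero (-(2 * Real.pi * I * (n * z)))
  rw [h, hg.add_I, h2] at h1
  have h3 : (d * cexp (2 * Real.pi * I * (k * I))) *
      (cexp (-(2 * Real.pi * I * (n * z))) * f z) =
      c * (cexp (-(2 * Real.pi * I * (n * z))) * f z) := by
    rw [← mul_assoc c, ← h1, h z]
    ring
  exact (mul_right_cancel₀ (mul_ne_zero hE hz) h3).symm

lemma isLattice_of_exp_eq_one {k : ℤ} {s : ℂ}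
    (h : cexp (2 * Real.pi * I * s) * cexp (2 * Real.pi * I * (k * I)) = 1) : IsLattice s := by
  refine exists_of_nome_zpow_mul_exp (k := k) ?_
  rw [mul_comm, nome, ← Complex.exp_int_mul]
  convert h using 3
  linear_combination (-2 * Real.pi * k) * I_mul_I

lemma eq_zero_of_exp_eq_one {k : ℤ} (h : cexp (2 * Real.pi * I * (k * I)) = 1) : k = 0 := by
  have h1 := congrArg norm h
  rw [Complex.norm_exp] at h1
  simpa [Real.pi_ne_zero] using h1

/-- Theta functions of degree `n` and multiplier `(-1) ^ n` are, up to a scalar, products of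
translated theta functions with total translation zero. -/
lemma IsThetaFun.exists_factorization_sum_eq_zero {n : ℕ} {f : ℂ → ℂ}
    (hf : IsThetaFun n ((-1) ^ n) f) (h0 : ∃ z, f z ≠ 0) :
    ∃ a : ℂ, a ≠ 0 ∧ ∃ M : Multiset ℂ, M.card = n ∧ M.sum = 0 ∧ ∀ z, f z = a * thetaProd M z := by
  suffices H : ∃ a : ℂ, a ≠ 0 ∧ ∃ k : ℤ, ∃ M : Multiset ℂ, M.card = n ∧ M.sum = 0 ∧
      ∀ z, f z = a * cexp (2 * Real.pi * I * (k * z)) * thetaProd M z by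
    obtain ⟨a, ha, k, M, hM, hs, h⟩ := H
    have hg := isThetaFun_thetaProd M
    rw [hM, hs, mul_zero, Complex.exp_zero, mul_one] at hg
    have h1 := hf.factor_eq_mul hg h0 h
    have hk : k = 0 := eq_zero_of_exp_eq_one
      (mul_left_cancel₀ (pow_ne_zero n (neg_ne_zero.2 one_ne_zero))
        (h1.symm.trans (mul_one _).symm))
    exact ⟨a, ha, M, hM, hs, fun z ↦ by simp [h, hk]⟩
  obtain ⟨a, ha, k, M, hM, h⟩ :=
    hf.exists_factorization (pow_ne_zero n (neg_ne_zero.2 one_ne_zero)) h0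
  rcases Multiset.empty_or_exists_mem M with rfl | ⟨w, hw⟩
  · exact ⟨a, ha, k, 0, hM, rfl, h⟩
  · have hg := isThetaFun_thetaProd M
    rw [hM] at hg
    have h1 := hf.factor_eq_mul hg h0 h
    rw [mul_assoc] at h1
    have hl : IsLattice M.sum := isLattice_of_exp_eq_one
      (mul_left_cancel₀ (pow_ne_zero n (neg_ne_zero.2 one_ne_zero))
        (h1.symm.trans (mul_one _).symm))
    obtain ⟨N, rfl⟩ := Multiset.exists_cons_of_mem hw
    obtain ⟨b, hb, l, h2⟩ := exists_thetaProd_eq (M := w ::ₘ N)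
      (M' := (w - (w ::ₘ N).sum) ::ₘ N) (by
        rw [Multiset.map_cons, Multiset.map_cons]
        congr 1
        rw [latticeExp_eq_iff]
        simpa using hl)
    refine ⟨a * b, mul_ne_zero ha hb, k + l, (w - (w ::ₘ N).sum) ::ₘ N,
      by simpa using hM, by simp, fun z ↦ ?_⟩
    rw [h, h2]
    push_cast
    rw [add_mul, mul_add, Complex.exp_add]
    ring

/-- Points at which theta functions of degree `n` and multiplier `(-1) ^ n` can be interpolated. -/
structure IsInterpolating {n : ℕ} (p : Fin n → ℂ) : Prop where
  not_isLattice_sub : ∀ i j, i ≠ j → ¬ IsLattice (p i - p j)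
  not_isLattice_sum : ¬ IsLattice (∑ i, p i)

lemma exists_isInterpolating {n : ℕ} (hn : 1 ≤ n) : ∃ p : Fin n → ℂ, IsInterpolating p := by
  have hn0 : (0 : ℝ) < n := by exact_mod_cast hn
  refine ⟨fun i ↦ ⟨i / n, 1 / (2 * n)⟩, fun i j hij ↦ ?_, ?_⟩
  · rintro ⟨a, b, h⟩
    have h1 : ((i : ℝ) / n - j / n) = a := by simpa using congrArg Complex.re h
    have h2 : ((i : ℝ) - j) = a * n := by
      field_simp at h1
      linarith
    have h3 : ((i : ℤ) - j) = a * n := by exact_mod_cast h2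
    have hi := i.2
    have hj := j.2
    have ha : a = 0 := by
      rcases lt_trichotomy a 0 with h | h | h
      · nlinarith
      · exact h
      · nlinarith
    rw [ha] at h3
    exact hij (Fin.ext (by omega))
  · rintro ⟨a, b, h⟩
    have h1 := congrArg Complex.im h
    simp only [Complex.im_sum, Finset.sum_const, Finset.card_univ, Fintype.card_fin,
      nsmul_eq_mul] at h1
    have h2 : (1 : ℝ) = 2 * b := by
      have : (n : ℝ) * (1 / (2 * n)) = b := by simpa using h1
      field_simp at this
      linarith
    have h3 : (1 : ℤ) = 2 * b := by exact_mod_cast h2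
    omega

namespace IsInterpolating

variable {n : ℕ} {p : Fin n → ℂ}

lemma eq_zero (hp : IsInterpolating p) {f : ℂ → ℂ} (hf : IsThetaFun n ((-1) ^ n) f)
    (h : ∀ j, f (p j) = 0) (z : ℂ) : f z = 0 := by
  by_contra hz
  obtain ⟨a, ha, M, hM, hs, hfM⟩ := hf.exists_factorization_sum_eq_zero ⟨z, hz⟩
  set N : Multiset ℂ := Finset.univ.val.map p with hN
  have hinj : Function.Injective fun j ↦ latticeExp (p j) := fun i j hij ↦ by
    by_contra hne
    exact hp.not_isLattice_sub i j hne (latticeExp_eq_iff.1 hij)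
  have hmap : N.map latticeExp = M.map latticeExp := by
    refine Multiset.eq_of_le_of_card_le ((Multiset.le_iff_subset ?_).2 ?_) (by simp [hN, hM])
    · rw [hN, Multiset.map_map]
      exact Finset.univ.nodup.map hinj
    · intro x hx
      rw [hN, Multiset.map_map] at hx
      obtain ⟨j, -, rfl⟩ := Multiset.mem_map.1 hx
      refine thetaProd_eq_zero_iff.1 ?_
      have := h j
      rw [hfM] at this
      simpa [ha] using this
  obtain ⟨b, hb, k, h1⟩ := exists_thetaProd_eq hmap.symm
  have hMt := isThetaFun_thetaProd M
  have hNt := isThetaFun_thetaProd N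
  have hNc : N.card = n := by simp [hN]
  have hNs : N.sum = ∑ i, p i := rfl
  rw [hM, hs, mul_zero, Complex.exp_zero] at hMt
  rw [hNc, hNs] at hNt
  have h2 := hMt.factor_eq_mul hNt (exists_thetaProd_ne_zero M) h1
  rw [mul_assoc] at h2
  exact hp.not_isLattice_sum (isLattice_of_exp_eq_one
    (mul_left_cancel₀ (pow_ne_zero n (neg_ne_zero.2 one_ne_zero)) h2.symm))

lemma exists_eq (hp : IsInterpolating p) (v : Fin n → ℂ) :
    ∃ f, IsThetaFun n ((-1) ^ n) f ∧ ∀ j, f (p j) = v j := by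
  have key : ∀ i, ∃ f, IsThetaFun n ((-1) ^ n) f ∧ f (p i) ≠ 0 ∧ ∀ j, j ≠ i → f (p j) = 0 := by
    intro i
    set N : Multiset ℂ := (p i - ∑ j, p j) ::ₘ (Finset.univ.erase i).val.map p with hN
    have hNc : N.card = n := by
      have : 0 < n := i.pos
      simp [hN]
      omega
    have hNs : N.sum = 0 := by
      have : ((Finset.univ.erase i).val.map p).sum = ∑ j ∈ Finset.univ.erase i, p j := rfl
      rw [hN, Multiset.sum_cons, this]
      have := Finset.add_sum_erase Finset.univ p (Finset.mem_univ i)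
      linear_combination this
    refine ⟨thetaProd N, ?_, ?_, fun j hj ↦ ?_⟩
    · simpa [hNc, hNs] using isThetaFun_thetaProd N
    · rw [Ne, thetaProd_eq_zero_iff, hN, Multiset.map_cons, Multiset.mem_cons, latticeExp_eq_iff,
        sub_sub_cancel, not_or]
      refine ⟨hp.not_isLattice_sum, fun h ↦ ?_⟩
      rw [Multiset.map_map] at h
      obtain ⟨j, hj, hij⟩ := Multiset.mem_map.1 h
      exact hp.not_isLattice_sub j i (Finset.mem_erase.1 (show j ∈ Finset.univ.erase i from hj)).1
        (latticeExp_eq_iff.1 hij)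
    · rw [thetaProd_eq_zero_iff, hN]
      refine Multiset.mem_map_of_mem _ (Multiset.mem_cons_of_mem (Multiset.mem_map_of_mem _ ?_))
      exact Finset.mem_erase.2 ⟨hj, Finset.mem_univ j⟩
  choose F hF hne hzero using key
  refine ⟨_, IsThetaFun.sum Finset.univ (fun i ↦ v i / F i (p i)) fun i _ ↦ hF i, fun j ↦ ?_⟩
  rw [Finset.sum_eq_single j (fun i _ hi ↦ by rw [hzero i j hi.symm, mul_zero]) (by simp),
    div_mul_cancel₀ _ (hne j)]

lemma exists_thetaProd_ne_zero (hp : IsInterpolating p) {M : Multiset ℂ} (hM : M.card = n)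
    (hs : M.sum = 0) : ∃ j, thetaProd M (p j) ≠ 0 := by
  by_contra! h
  obtain ⟨z, hz⟩ := SquareTheta.exists_thetaProd_ne_zero M
  exact hz (hp.eq_zero (by simpa [hM, hs] using isThetaFun_thetaProd M) h z)

lemma exists_thetaProd_eq_mul (hp : IsInterpolating p) {v : Fin n → ℂ} (hv : v ≠ 0) :
    ∃ a : ℂ, a ≠ 0 ∧ ∃ M : Multiset ℂ, M.card = n ∧ M.sum = 0 ∧
      ∀ j, v j = a * thetaProd M (p j) := by
  obtain ⟨f, hf, hfv⟩ := hp.exists_eq v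
  obtain ⟨j, hj⟩ := Function.ne_iff.1 hv
  obtain ⟨a, ha, M, hM, hs, h⟩ := hf.exists_factorization_sum_eq_zero
    ⟨p j, by rw [hfv]; exact hj⟩
  exact ⟨a, ha, M, hM, hs, fun j ↦ by rw [← hfv, h]⟩

lemma exists_mul_thetaProd_iff (hp : IsInterpolating p) {M M' : Multiset ℂ} (hM : M.card = n)
    (hs : M.sum = 0) (hM' : M'.card = n) (hs' : M'.sum = 0) :
    (∃ a : ℂ, a ≠ 0 ∧ ∀ j, thetaProd M (p j) = a * thetaProd M' (p j)) ↔
      M.map latticeExp = M'.map latticeExp := by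
  have ht : IsThetaFun n ((-1) ^ n) (thetaProd M) := by
    simpa [hM, hs] using isThetaFun_thetaProd M
  have ht' : IsThetaFun n ((-1) ^ n) (thetaProd M') := by
    simpa [hM', hs'] using isThetaFun_thetaProd M'
  constructor
  · rintro ⟨a, ha, h⟩
    refine map_latticeExp_eq ha (k := 0) fun z ↦ ?_
    have := hp.eq_zero (ht.add_smul ht' 1 (-a)) (fun j ↦ by rw [h]; ring) z
    simp only [Int.cast_zero, zero_mul, mul_zero, Complex.exp_zero]
    linear_combination this
  · intro h
    obtain ⟨a, ha, k, h1⟩ := exists_thetaProd_eq h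
    have h2 := ht.factor_eq_mul ht' (SquareTheta.exists_thetaProd_ne_zero M) h1
    have hk : k = 0 := eq_zero_of_exp_eq_one
      (mul_left_cancel₀ (pow_ne_zero n (neg_ne_zero.2 one_ne_zero))
        (h2.symm.trans (mul_one _).symm))
    exact ⟨a, ha, fun j ↦ by simp [h1, hk]⟩

end IsInterpolating

end SquareTheta

section ProjectiveSpace

variable {n : ℕ}

lemma isQuotientMap_projectivization_mk (n : ℕ) : Topology.IsQuotientMap
    fun v : {v : Fin n → ℂ // v ≠ 0} ↦ Projectivization.mk ℂ (v : Fin n → ℂ) v.2 :=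
  isQuotientMap_quotient_mk'

/-- The orthogonal projection matrix onto the line spanned by a vector. -/
noncomputable def lineProjection (v : Fin n → ℂ) (i j : Fin n) : ℂ :=
  v i * starRingEnd ℂ (v j) / ∑ k, v k * starRingEnd ℂ (v k)

lemma sum_mul_conj_ne_zero {v : Fin n → ℂ} (hv : v ≠ 0) :
    ∑ k, v k * starRingEnd ℂ (v k) ≠ 0 := by
  simp_rw [Complex.mul_conj]
  rw [← Complex.ofReal_sum, Complex.ofReal_ne_zero]
  obtain ⟨j, hj⟩ := Function.ne_iff.1 hv
  exact (Finset.sum_pos' (fun i _ ↦ Complex.normSq_nonneg _)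
    ⟨j, Finset.mem_univ j, Complex.normSq_pos.2 hj⟩).ne'

lemma lineProjection_smul {a : ℂ} (ha : a ≠ 0) (v : Fin n → ℂ) :
    lineProjection (a • v) = lineProjection v := by
  ext i j
  simp only [lineProjection, Pi.smul_apply, smul_eq_mul, map_mul]
  have h : ∑ k, a * v k * (starRingEnd ℂ a * starRingEnd ℂ (v k)) =
      (a * starRingEnd ℂ a) * ∑ k, v k * starRingEnd ℂ (v k) := by
    rw [Finset.mul_sum]
    exact Finset.sum_congr rfl fun k _ ↦ by ring
  rw [h, show a * v i * (starRingEnd ℂ a * starRingEnd ℂ (v j)) =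
    (a * starRingEnd ℂ a) * (v i * starRingEnd ℂ (v j)) by ring]
  exact mul_div_mul_left _ _ (mul_ne_zero ha ((map_ne_zero _).2 ha))

lemma exists_smul_eq_of_lineProjection_eq {v w : Fin n → ℂ} (hv : v ≠ 0)
    (h : lineProjection v = lineProjection w) : ∃ a : ℂ, a • w = v := by
  obtain ⟨j, hj⟩ := Function.ne_iff.1 hv
  have hj' : starRingEnd ℂ (v j) ≠ 0 := (map_ne_zero _).2 hj
  have hv' := sum_mul_conj_ne_zero hv
  refine ⟨starRingEnd ℂ (w j) / (∑ k, w k * starRingEnd ℂ (w k)) *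
    ((∑ k, v k * starRingEnd ℂ (v k)) / starRingEnd ℂ (v j)), ?_⟩
  ext i
  have hij := congrFun (congrFun h i) j
  rw [lineProjection, lineProjection] at hij
  rw [Pi.smul_apply, smul_eq_mul]
  calc _ = w i * starRingEnd ℂ (w j) / (∑ k, w k * starRingEnd ℂ (w k)) *
        ((∑ k, v k * starRingEnd ℂ (v k)) / starRingEnd ℂ (v j)) := by ring
    _ = v i := by rw [← hij]; field_simp

instance t2Space_projectivization (n : ℕ) : T2Space (Projectivization ℂ (Fin n → ℂ)) := by
  let F : Projectivization ℂ (Fin n → ℂ) → Fin n → Fin n → ℂ :=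
    Projectivization.lift (fun v : {v : Fin n → ℂ // v ≠ 0} ↦ lineProjection (v : Fin n → ℂ))
      (fun v w a h ↦ by
        have ha : a ≠ 0 := fun ha ↦ v.2 (by rw [h, ha, zero_smul])
        simp only [h]
        exact lineProjection_smul ha _)
  refine T2Space.of_injective_continuous (f := F) ?_ ?_
  · intro x y
    induction x using Projectivization.ind with | h v hv => ?_
    induction y using Projectivization.ind with | h w hw => ?_
    intro h
    rw [Projectivization.mk_eq_mk_iff']
    exact exists_smul_eq_of_lineProjection_eq hv h
  · rw [(isQuotientMap_projectivization_mk n).continuous_iff]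
    change Continuous fun v : {v : Fin n → ℂ // v ≠ 0} ↦ lineProjection (v : Fin n → ℂ)
    have hc (i : Fin n) : Continuous fun v : {v : Fin n → ℂ // v ≠ 0} ↦ (v : Fin n → ℂ) i :=
      (continuous_apply i).comp continuous_subtype_val
    have hc' (i j : Fin n) := (hc i).mul (Complex.continuous_conj.comp (hc j))
    exact continuous_pi fun i ↦ continuous_pi fun j ↦ (hc' i j).div
      (continuous_finsetSum _ fun k _ ↦ hc' k k) fun v ↦ sum_mul_conj_ne_zero v.2

end ProjectiveSpace

section Tuples

variable {n : ℕ} {α β : Type*}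

/-- The multiset of entries of a tuple. -/
def entries (x : Fin n → α) : Multiset α := Finset.univ.val.map x

@[simp] lemma card_entries (x : Fin n → α) : (entries x).card = n := by simp [entries]

lemma map_entries (f : α → β) (x : Fin n → α) : (entries x).map f = entries fun i ↦ f (x i) :=
  Multiset.map_map _ _ _

lemma sum_entries [AddCommMonoid α] (x : Fin n → α) : (entries x).sum = ∑ i, x i := rfl

lemma entries_comp_perm (x : Fin n → α) (σ : Equiv.Perm (Fin n)) :
    entries (fun i ↦ x (σ i)) = entries x := by
  rw [entries, entries, ← Function.comp_def, ← Multiset.map_map, Multiset.map_univ_val_equiv]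

lemma exists_entries_eq {M : Multiset α} (hM : M.card = n) : ∃ x : Fin n → α, entries x = M := by
  induction M using Quotient.inductionOn with | h l => ?_
  obtain rfl : l.length = n := hM
  refine ⟨l.get, ?_⟩
  rw [entries, Fin.univ_val_map]
  simp

lemma entries_eq_iff {x y : Fin n → α} :
    entries x = entries y ↔ ∃ σ : Equiv.Perm (Fin n), ∀ i, x (σ i) = y i := by
  classical
  refine ⟨fun h ↦ ?_, fun ⟨σ, h⟩ ↦ by rw [← entries_comp_perm x σ, funext h]⟩
  have hc : ∀ a, Nonempty ({i // y i = a} ≃ {i // x i = a}) := fun a ↦ by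
    refine Fintype.card_eq.1 ?_
    have h1 := congrArg (Multiset.count a) h
    rw [entries, entries, Multiset.count_map, Multiset.count_map] at h1
    rw [Fintype.card_subtype, Fintype.card_subtype]
    simp only [eq_comm (a := a)] at h1
    exact h1.symm
  let e := fun a ↦ (hc a).some
  refine ⟨(Equiv.sigmaFiberEquiv y).symm.trans
    ((Equiv.sigmaCongrRight e).trans (Equiv.sigmaFiberEquiv x)), fun i ↦ ?_⟩
  exact (e (y i) ⟨i, rfl⟩).2

end Tuples

section TorusPairs

open Complex SquareTheta

/-- Pairs of diagonal matrices of determinant one, as tuples of pairs of eigenvalues. -/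
def detOnePairs (n : ℕ) : Set (Fin n → ℂ × ℂ) := {x | ∏ i, (x i).1 = 1 ∧ ∏ i, (x i).2 = 1}

/-- Pairs of diagonal unitary matrices of determinant one. -/
def unitPairs (n : ℕ) : Set (Fin n → ℂ × ℂ) :=
  {x | x ∈ detOnePairs n ∧ ∀ i, ‖(x i).1‖ = 1 ∧ ‖(x i).2‖ = 1}

/-- A compact set of logarithms, covering all pairs of diagonal unitary matrices of determinant
one. -/
def logBox (n : ℕ) : Set (Fin n → ℂ) :=
  {w | ∑ i, w i = 0 ∧ ∀ i, w i ∈ Set.Icc (-n : ℝ) n ×ℂ Set.Icc (-n : ℝ) n}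

lemma isCompact_logBox (n : ℕ) : IsCompact (logBox n) := by
  have h : IsCompact (Set.univ.pi fun _ : Fin n ↦ Set.Icc (-n : ℝ) n ×ℂ Set.Icc (-n : ℝ) n) :=
    isCompact_univ_pi fun _ ↦ isCompact_Icc.reProdIm isCompact_Icc
  refine h.of_isClosed_subset ?_ ?_
  · have : logBox n = {w | ∑ i, w i = 0} ∩
        Set.univ.pi fun _ : Fin n ↦ Set.Icc (-n : ℝ) n ×ℂ Set.Icc (-n : ℝ) n := by
      ext w
      simp [logBox]
    rw [this]
    exact (isClosed_eq (by fun_prop) continuous_const).inter h.isClosed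
  · exact fun w hw i _ ↦ hw.2 i

lemma exists_real_logs {n : ℕ} (hn : 1 ≤ n) {s : Fin n → ℂ} (hs : ∀ i, ‖s i‖ = 1)
    (hp : ∏ i, s i = 1) : ∃ t : Fin n → ℝ, ∑ i, t i = 0 ∧ (∀ i, t i ∈ Set.Icc (-n : ℝ) n) ∧
      ∀ i, cexp (2 * Real.pi * I * t i) = s i := by
  have h1 : ∀ i, ∃ t : ℝ, t ∈ Set.Ico (0 : ℝ) 1 ∧ cexp (2 * Real.pi * I * t) = s i := fun i ↦ by
    obtain ⟨θ, hθ⟩ := (Complex.norm_eq_one_iff (s i)).1 (hs i)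
    refine ⟨Int.fract (θ / (2 * Real.pi)), ⟨Int.fract_nonneg _, Int.fract_lt_one _⟩, ?_⟩
    rw [← hθ, show (θ : ℂ) * I = 2 * Real.pi * I * ((θ / (2 * Real.pi) : ℝ) : ℂ) by
      push_cast; field_simp [Real.pi_ne_zero], exp_two_pi_mul_eq_iff]
    exact ⟨-⌊θ / (2 * Real.pi)⌋, by rw [Int.fract]; push_cast; ring⟩
  choose t ht hts using h1
  obtain ⟨m, hm⟩ : ∃ m : ℤ, ∑ i, t i - 0 = m := by
    rw [← exp_two_pi_mul_eq_iff]
    push_cast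
    rw [Finset.mul_sum, Complex.exp_sum]
    simp [hts, hp]
  rw [sub_zero] at hm
  have hm0 : (0 : ℝ) ≤ m := hm ▸ Finset.sum_nonneg fun i _ ↦ (ht i).1
  have hmn : (m : ℝ) ≤ n := by
    rw [← hm]
    simpa using Finset.sum_le_sum fun i (_ : i ∈ Finset.univ) ↦ (ht i).2.le
  have hn1 : (1 : ℝ) ≤ n := by exact_mod_cast hn
  let i₀ : Fin n := ⟨0, hn⟩
  refine ⟨fun i ↦ t i - if i = i₀ then (m : ℝ) else 0, ?_, fun i ↦ ?_, fun i ↦ ?_⟩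
  · rw [Finset.sum_sub_distrib, hm]
    simp
  · have := ht i
    dsimp only
    split_ifs <;> constructor <;> linarith [this.1, this.2]
  · rw [← hts i, exp_two_pi_mul_eq_iff]
    dsimp only
    split_ifs
    · exact ⟨-m, by push_cast; ring⟩
    · exact ⟨0, by simp⟩

lemma latticeExp_comp_mem_unitPairs {n : ℕ} {w : Fin n → ℂ} (hw : ∑ i, w i = 0) :
    (fun i ↦ latticeExp (w i)) ∈ unitPairs n := by
  refine ⟨⟨?_, ?_⟩, fun i ↦ ⟨?_, ?_⟩⟩
  · simp only [latticeExp]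
    rw [← Complex.exp_sum, ← Finset.mul_sum, ← Complex.ofReal_sum, ← Complex.re_sum, hw]
    simp
  · simp only [latticeExp]
    rw [← Complex.exp_sum, ← Finset.mul_sum, ← Complex.ofReal_sum, ← Complex.im_sum, hw]
    simp
  · simp [latticeExp, Complex.norm_exp]
  · simp [latticeExp, Complex.norm_exp]

/-- The exponential map from the logarithms to the maximal torus. -/
noncomputable def boxExp (n : ℕ) (w : logBox n) : unitPairs n :=
  ⟨fun i ↦ latticeExp (w.1 i), latticeExp_comp_mem_unitPairs w.2.1⟩

lemma continuous_boxExp (n : ℕ) : Continuous (boxExp n) :=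
  Continuous.subtype_mk (continuous_pi fun i ↦ continuous_latticeExp.comp
    ((continuous_apply i).comp continuous_subtype_val)) _

lemma boxExp_surjective {n : ℕ} (hn : 1 ≤ n) : Function.Surjective (boxExp n) := by
  rintro ⟨x, hx⟩
  obtain ⟨s, hs0, hs, hsx⟩ := exists_real_logs hn (fun i ↦ (hx.2 i).1) hx.1.1
  obtain ⟨t, ht0, ht, htx⟩ := exists_real_logs hn (fun i ↦ (hx.2 i).2) hx.1.2
  refine ⟨⟨fun i ↦ ⟨s i, t i⟩, ?_, fun i ↦ ⟨hs i, ht i⟩⟩, ?_⟩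
  · apply Complex.ext <;> simp [hs0, ht0]
  · refine Subtype.ext (funext fun i ↦ Prod.ext ?_ ?_)
    · exact hsx i
    · exact htx i

/-- The values at `p` of the theta function with prescribed zeros. -/
noncomputable def thetaPoint {n : ℕ} {p : Fin n → ℂ} (hp : IsInterpolating p) (w : logBox n) :
    {v : Fin n → ℂ // v ≠ 0} :=
  ⟨fun j ↦ thetaProd (entries w.1) (p j), by
    obtain ⟨j, hj⟩ := hp.exists_thetaProd_ne_zero (card_entries w.1) w.2.1
    exact Function.ne_iff.2 ⟨j, hj⟩⟩

lemma continuous_thetaPoint {n : ℕ} {p : Fin n → ℂ} (hp : IsInterpolating p) :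
    Continuous (thetaPoint hp) := by
  refine Continuous.subtype_mk (continuous_pi fun j ↦ ?_) _
  have h : ∀ w : logBox n, thetaProd (entries w.1) (p j) = ∏ i, theta (p j - w.1 i) := fun w ↦ by
    rw [thetaProd, map_entries]; rfl
  simp_rw [h]
  exact continuous_finsetProd _ fun i _ ↦ isThetaFun_theta.differentiable.continuous.comp
    (continuous_const.sub ((continuous_apply i).comp continuous_subtype_val))

/-- The quotient of the space of pairs of diagonal special unitary matrices by the symmetric group
is a projective space. -/
theorem exists_isQuotientMap_unitPairs {n : ℕ} (hn : 1 ≤ n) :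
    ∃ Φ : unitPairs n → Projectivization ℂ (Fin n → ℂ), Topology.IsQuotientMap Φ ∧
      ∀ x y : unitPairs n, Φ x = Φ y ↔ entries x.1 = entries y.1 := by
  obtain ⟨p, hp⟩ := exists_isInterpolating hn
  have : CompactSpace (logBox n) := isCompact_iff_compactSpace.1 (isCompact_logBox n)
  let Θ : logBox n → Projectivization ℂ (Fin n → ℂ) := fun w ↦
    Projectivization.mk ℂ (thetaPoint hp w : Fin n → ℂ) (thetaPoint hp w).2
  have hΘ : Continuous Θ :=
    (isQuotientMap_projectivization_mk n).continuous.comp (continuous_thetaPoint hp)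
  have hiff : ∀ w w' : logBox n, Θ w = Θ w' ↔
      entries (boxExp n w).1 = entries (boxExp n w').1 := fun w w' ↦ by
    have h := hp.exists_mul_thetaProd_iff (card_entries w.1) w.2.1 (card_entries w'.1) w'.2.1
    rw [map_entries, map_entries] at h
    refine Iff.trans ?_ h
    rw [Projectivization.mk_eq_mk_iff]
    constructor
    · rintro ⟨a, ha⟩
      exact ⟨a, a.ne_zero, fun j ↦ (congrFun ha j).symm⟩
    · rintro ⟨a, ha, h⟩
      exact ⟨Units.mk0 a ha, funext fun j ↦ (h j).symm⟩
  have hsurj : Function.Surjective Θ := fun P ↦ by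
    induction P using Projectivization.ind with | h v hv => ?_
    obtain ⟨a, ha, M, hM, hs, hva⟩ := hp.exists_thetaProd_eq_mul hv
    obtain ⟨u, hu⟩ := exists_entries_eq hM
    have hu0 : ∑ i, u i = 0 := by rw [← sum_entries, hu, hs]
    obtain ⟨w, hw⟩ := boxExp_surjective hn ⟨_, latticeExp_comp_mem_unitPairs hu0⟩
    have h : (entries w.1).map latticeExp = M.map latticeExp := by
      rw [← hu, map_entries, map_entries]
      exact congrArg (fun x : unitPairs n ↦ entries x.1) hw
    obtain ⟨b, hb, hwb⟩ :=
      (hp.exists_mul_thetaProd_iff (card_entries w.1) w.2.1 hM hs).2 h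
    refine ⟨w, ?_⟩
    rw [Projectivization.mk_eq_mk_iff']
    refine ⟨b / a, funext fun j ↦ ?_⟩
    rw [Pi.smul_apply, smul_eq_mul, hva]
    change _ = thetaProd (entries w.1) (p j)
    rw [hwb]
    field_simp
  have hκ : Topology.IsQuotientMap (boxExp n) := .of_surjective_continuous
    (boxExp_surjective hn) (continuous_boxExp n)
  let Φ : unitPairs n → Projectivization ℂ (Fin n → ℂ) := fun x ↦ Θ (hκ.surjective x).choose
  have hΦ : Φ ∘ boxExp n = Θ := funext fun w ↦ (hiff _ _).2 (by
    rw [(hκ.surjective (boxExp n w)).choose_spec])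
  refine ⟨Φ, ?_, fun x y ↦ ?_⟩
  · refine .of_comp hκ.continuous (hκ.continuous_iff.2 (hΦ ▸ hΘ)) ?_
    rw [hΦ]
    exact .of_surjective_continuous hsurj hΘ
  · rw [hiff, (hκ.surjective x).choose_spec, (hκ.surjective y).choose_spec]

end TorusPairs

section Diagonalization

variable {n : ℕ}

lemma IsSemisimpleMat.isSemisimple_toLin' {A : Matrix (Fin n) (Fin n) ℂ}
    (hA : IsSemisimpleMat A) : Module.End.IsSemisimple (Matrix.toLin' A) := by
  obtain ⟨P, Q, hPQ, hQP, hD⟩ := hA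
  set d := (Q * A * P).diag with hd
  have hAP : A * P = P * Matrix.diagonal d := by
    rw [hd, hD.diagonal_diag, ← Matrix.mul_assoc, ← Matrix.mul_assoc, hPQ, Matrix.one_mul]
  let p : Polynomial ℂ := ∏ μ ∈ Finset.univ.image d, (Polynomial.X - Polynomial.C μ)
  refine Module.End.isSemisimple_of_squarefree_aeval_eq_zero (p := p) ?_ ?_
  · exact (Polynomial.separable_prod_X_sub_C_iff'.2 fun _ _ _ _ h ↦ h).squarefree
  · have hcol : ∀ j, Polynomial.aeval (Matrix.toLin' A) p (P.col j) = 0 := fun j ↦ by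
      by_cases h0 : P.col j = 0
      · rw [h0, map_zero]
      · have hj : Module.End.HasEigenvector (Matrix.toLin' A) (d j) (P.col j) := by
          refine ⟨Module.End.mem_eigenspace_iff.2 (funext fun i ↦ ?_), h0⟩
          have := congrFun (congrFun hAP i) j
          rw [Matrix.mul_diagonal] at this
          rw [Matrix.toLin'_apply, Pi.smul_apply, smul_eq_mul, mul_comm]
          exact this
        rw [Module.End.aeval_apply_of_hasEigenvector hj, Polynomial.eval_prod,
          Finset.prod_eq_zero (Finset.mem_image_of_mem d (Finset.mem_univ j)) (by simp), zero_smul]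
    have hcomp : Polynomial.aeval (Matrix.toLin' A) p ∘ₗ Matrix.toLin' P = 0 := by
      refine (Pi.basisFun ℂ (Fin n)).ext fun j ↦ ?_
      simpa using hcol j
    calc Polynomial.aeval (Matrix.toLin' A) p
        = Polynomial.aeval (Matrix.toLin' A) p ∘ₗ Matrix.toLin' P ∘ₗ Matrix.toLin' Q := by
          rw [← Matrix.toLin'_mul, hPQ, Matrix.toLin'_one, LinearMap.comp_id]
      _ = 0 := by rw [← LinearMap.comp_assoc, hcomp, LinearMap.zero_comp]

/-- Commuting diagonalizable matrices are simultaneously diagonalizable. -/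
lemma exists_simultaneous_diagonalization {m : ℕ} {f : Fin m → Matrix (Fin n) (Fin n) ℂ}
    (hf : ∀ i, IsSemisimpleMat (f i)) (hc : ∀ i j, f i * f j = f j * f i) :
    ∃ g gi : Matrix (Fin n) (Fin n) ℂ, g * gi = 1 ∧ gi * g = 1 ∧
      ∃ a : Fin m → Fin n → ℂ, ∀ i, g * f i * gi = Matrix.diagonal (a i) := by
  let E : Set (Fin n → ℂ) := {v | ∀ i, ∃ c : ℂ, f i *ᵥ v = c • v}
  have hE : Submodule.span ℂ E = ⊤ := by
    have h := Module.End.iSup_iInf_maxGenEigenspace_eq_top_of_iSup_maxGenEigenspace_eq_top_of_commute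
      (fun i ↦ Matrix.toLin' (f i))
      (fun i j _ ↦ by
        change Commute (Matrix.toLin' (f i)) (Matrix.toLin' (f j))
        rw [commute_iff_eq, Module.End.mul_eq_comp, Module.End.mul_eq_comp, ← Matrix.toLin'_mul,
          ← Matrix.toLin'_mul, hc])
      (fun i ↦ Module.End.iSup_maxGenEigenspace_eq_top _)
    rw [eq_top_iff, ← h, iSup_le_iff]
    intro χ v hv
    refine Submodule.subset_span fun i ↦ ⟨χ i, ?_⟩
    have hvi := (Submodule.mem_iInf _).1 hv i
    rw [(hf i).isSemisimple_toLin'.isFinitelySemisimple.maxGenEigenspace_eq_eigenspace,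
      Module.End.mem_eigenspace_iff] at hvi
    simpa using hvi
  obtain ⟨b, hbE, hspan, hli⟩ := exists_linearIndependent ℂ E
  rw [hE] at hspan
  let B := Module.Basis.mk hli (by rw [Subtype.range_coe, hspan])
  have : Finite b := Module.Finite.finite_basis B
  have : Fintype b := Fintype.ofFinite b
  let e := B.reindex (Fintype.equivOfCardEq (β := Fin n) (by
    rw [← Module.finrank_eq_card_basis B, Module.finrank_fin_fun, Fintype.card_fin]))
  have he : ∀ j, e j ∈ E := fun j ↦ by
    rw [Module.Basis.reindex_apply, Module.Basis.mk_apply]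
    exact hbE (Subtype.coe_prop _)
  choose a ha using he
  let g := e.toMatrix (Pi.basisFun ℂ (Fin n))
  let gi := (Pi.basisFun ℂ (Fin n)).toMatrix e
  have hg : g * gi = 1 := e.toMatrix_mul_toMatrix_flip _
  refine ⟨g, gi, hg, (Pi.basisFun ℂ (Fin n)).toMatrix_mul_toMatrix_flip _, fun i j ↦ a j i,
    fun i ↦ ?_⟩
  have : f i * gi = gi * Matrix.diagonal fun j ↦ a j i := by
    ext k j
    rw [Matrix.mul_diagonal, mul_comm]
    exact congrFun (ha j i) k
  rw [Matrix.mul_assoc, this, ← Matrix.mul_assoc, hg, Matrix.one_mul]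

/-- Conjugation by an invertible matrix can be realised by a matrix of determinant one. -/
lemma conjRel_of_mul_eq_one {m : ℕ} (hn : 1 ≤ n) {S : Set (Fin m → Matrix (Fin n) (Fin n) ℂ)}
    {s t : S} {g gi : Matrix (Fin n) (Fin n) ℂ} (h : g * gi = 1) (h' : gi * g = 1)
    (hst : ∀ i, g * s.1 i * gi = t.1 i) : conjRel (SLset n) S s t := by
  have hdet : g.det * gi.det = 1 := by rw [← Matrix.det_mul, h, Matrix.det_one]
  obtain ⟨c, hc⟩ := IsAlgClosed.exists_pow_nat_eq g.det hn
  have hc0 : c ≠ 0 := by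
    rintro rfl
    rw [zero_pow (by omega)] at hc
    rw [← hc, zero_mul] at hdet
    exact zero_ne_one hdet
  refine ⟨c⁻¹ • g, c • gi, ?_, ?_, ?_, ?_, fun i ↦ ?_⟩
  · rw [SLset, Set.mem_ofPred_eq, Matrix.det_smul, Fintype.card_fin, ← hc, inv_pow,
      inv_mul_cancel₀ (pow_ne_zero _ hc0)]
  · rw [SLset, Set.mem_ofPred_eq, Matrix.det_smul, Fintype.card_fin, hc, hdet]
  · rw [Matrix.smul_mul, Matrix.mul_smul, smul_smul, inv_mul_cancel₀ hc0, one_smul, h]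
  · rw [Matrix.smul_mul, Matrix.mul_smul, smul_smul, mul_inv_cancel₀ hc0, one_smul, h']
  · rw [Matrix.smul_mul, Matrix.smul_mul, Matrix.mul_smul, smul_smul, inv_mul_cancel₀ hc0,
      one_smul, hst]

/-- The determinantal pencil of a pair of matrices. -/
noncomputable def pencil (s : Fin 2 → Matrix (Fin n) (Fin n) ℂ) (l z : ℂ) : ℂ :=
  (z • (1 : Matrix (Fin n) (Fin n) ℂ) - (s 0 + l • s 1)).det

lemma continuous_pencil (l z : ℂ) :
    Continuous fun s : Fin 2 → Matrix (Fin n) (Fin n) ℂ ↦ pencil s l z := by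
  unfold pencil
  refine Continuous.matrix_det ?_
  fun_prop

lemma pencil_conj {s t : Fin 2 → Matrix (Fin n) (Fin n) ℂ} {g gi : Matrix (Fin n) (Fin n) ℂ}
    (h : g * gi = 1) (hst : ∀ i, g * s i * gi = t i) (l z : ℂ) :
    pencil t l z = pencil s l z := by
  have hdet : g.det * gi.det = 1 := by rw [← Matrix.det_mul, h, Matrix.det_one]
  have : z • (1 : Matrix (Fin n) (Fin n) ℂ) - (t 0 + l • t 1) =
      g * (z • (1 : Matrix (Fin n) (Fin n) ℂ) - (s 0 + l • s 1)) * gi := by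
    rw [← hst, ← hst]
    simp only [Matrix.mul_sub, Matrix.sub_mul, Matrix.mul_add, Matrix.add_mul, Matrix.mul_smul,
      Matrix.smul_mul, Matrix.mul_one, h]
  rw [pencil, this, Matrix.det_mul, Matrix.det_mul, pencil]
  linear_combination (z • (1 : Matrix (Fin n) (Fin n) ℂ) - (s 0 + l • s 1)).det * hdet

lemma pencil_diagonal (x : Fin n → ℂ × ℂ) (l z : ℂ) :
    pencil ![Matrix.diagonal fun i ↦ (x i).1, Matrix.diagonal fun i ↦ (x i).2] l z =
      ∏ i, (z - ((x i).1 + l * (x i).2)) := by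
  have : z • (1 : Matrix (Fin n) (Fin n) ℂ) - (Matrix.diagonal (fun i ↦ (x i).1) +
      l • Matrix.diagonal fun i ↦ (x i).2) =
      Matrix.diagonal fun i ↦ (z - ((x i).1 + l * (x i).2)) := by
    ext i j
    by_cases h : i = j <;> simp [h]
  rw [← Matrix.det_diagonal, ← this]
  rfl

lemma entries_eq_of_prod_eq {x y : Fin n → ℂ × ℂ}
    (h : ∀ l z : ℂ, ∏ i, (z - ((x i).1 + l * (x i).2)) = ∏ i, (z - ((y i).1 + l * (y i).2))) :
    entries x = entries y := by
  classical
  let T : Finset (ℂ × ℂ) := Finset.univ.image x ∪ Finset.univ.image y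
  obtain ⟨l, hl⟩ := ((T ×ˢ T).image fun q ↦ (q.1.1 - q.2.1) / (q.2.2 - q.1.2)).exists_notMem
  let φ : ℂ × ℂ → ℂ := fun a ↦ a.1 + l * a.2
  have hinj : Set.InjOn φ T := fun a ha b hb hab ↦ by
    have hab' : a.1 - b.1 = l * (b.2 - a.2) := by
      have : a.1 + l * a.2 = b.1 + l * b.2 := hab
      linear_combination this
    by_cases h2 : b.2 = a.2
    · exact Prod.ext (by rwa [h2, sub_self, mul_zero, sub_eq_zero] at hab') h2.symm
    · refine absurd (Finset.mem_image.2 ⟨(a, b), Finset.mem_product.2 ⟨ha, hb⟩, ?_⟩) hl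
      rw [hab']
      exact mul_div_cancel_right₀ _ (sub_ne_zero.2 h2)
  have hroots : ∀ u : Fin n → ℂ × ℂ, (∏ i, (Polynomial.X - Polynomial.C (φ (u i)))).roots =
      (entries u).map φ := fun u ↦ by
    rw [map_entries]
    convert Polynomial.roots_multiset_prod_X_sub_C (entries fun i ↦ φ (u i)) using 2
    rw [map_entries]
    rfl
  have hmap : (entries x).map φ = (entries y).map φ := by
    rw [← hroots, ← hroots]
    congr 1
    refine Polynomial.funext fun z ↦ ?_
    simpa [Polynomial.eval_prod] using h l z
  have hrec : ∀ u : Fin n → ℂ × ℂ, (∀ i, u i ∈ T) →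
      ((entries u).map φ).map (Function.invFunOn φ T) = entries u := fun u hu ↦ by
    rw [map_entries, map_entries]
    exact congrArg entries (funext fun i ↦ hinj.leftInvOn_invFunOn (hu i))
  rw [← hrec x (fun i ↦ by simp [T]), ← hrec y (fun i ↦ by simp [T]), hmap]

end Diagonalization

section CharacterVariety

open Filter Topology

variable {n : ℕ}

/-- A pair of tuples of eigenvalues, as a pair of diagonal matrices. -/
def diagPair (x : detOnePairs n) : ssTuples 2 (SLset n) :=
  ⟨![Matrix.diagonal fun i ↦ (x.1 i).1, Matrix.diagonal fun i ↦ (x.1 i).2], by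
    refine ⟨⟨fun i ↦ ?_, fun i j ↦ ?_⟩, fun i ↦ ⟨1, 1, mul_one _, mul_one _, ?_⟩⟩
    · fin_cases i
      · exact (Matrix.det_diagonal).trans x.2.1
      · exact (Matrix.det_diagonal).trans x.2.2
    · fin_cases i <;> fin_cases j <;> simp [mul_comm]
    · fin_cases i <;> simp⟩

lemma continuous_diagPair : Continuous (diagPair (n := n)) := by
  have h (i : Fin n) : Continuous fun x : detOnePairs n ↦ x.1 i :=
    (continuous_apply i).comp continuous_subtype_val
  refine Continuous.subtype_mk (continuous_pi fun k ↦ ?_) _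
  fin_cases k
  · exact (continuous_pi fun i ↦ continuous_fst.comp (h i)).matrix_diagonal
  · exact (continuous_pi fun i ↦ continuous_snd.comp (h i)).matrix_diagonal

/-- The conjugacy class of a pair of diagonal matrices. -/
def diagClass (x : detOnePairs n) : RepSpace (SLset n) (ssTuples 2 (SLset n)) :=
  Quot.mk _ (diagPair x)

lemma continuous_diagClass : Continuous (diagClass (n := n)) :=
  continuous_quot_mk.comp continuous_diagPair

lemma pencil_eq_of_quot_mk_eq {s t : ssTuples 2 (SLset n)}
    (h : Quot.mk (conjRel (SLset n) (ssTuples 2 (SLset n))) s = Quot.mk _ t) :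
    pencil s.1 = pencil t.1 := by
  refine congrArg (Quot.lift (fun s : ssTuples 2 (SLset n) ↦ pencil s.1) ?_) h
  rintro s t ⟨g, gi, -, -, h, -, hst⟩
  exact (funext fun l ↦ funext fun z ↦ pencil_conj h hst l z).symm

lemma diagClass_eq_iff (hn : 1 ≤ n) {x y : detOnePairs n} :
    diagClass x = diagClass y ↔ entries x.1 = entries y.1 := by
  refine ⟨fun h ↦ entries_eq_of_prod_eq fun l z ↦ ?_, fun h ↦ ?_⟩
  · rw [← pencil_diagonal, ← pencil_diagonal]
    exact congrFun (congrFun (pencil_eq_of_quot_mk_eq h) l) z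
  · obtain ⟨σ, hσ⟩ := entries_eq_iff.1 h
    have hconj : ∀ a : Fin n → ℂ, (1 : Matrix (Fin n) (Fin n) ℂ).submatrix σ (Equiv.refl _) *
        Matrix.diagonal a * (1 : Matrix (Fin n) (Fin n) ℂ).submatrix (Equiv.refl _) σ =
        Matrix.diagonal (a ∘ σ) := fun a ↦ by
      rw [Matrix.one_submatrix_mul, Matrix.mul_submatrix_one]
      exact Matrix.submatrix_diagonal _ _ σ.injective
    have h1 : (1 : Matrix (Fin n) (Fin n) ℂ).submatrix σ (Equiv.refl _) *
        (1 : Matrix (Fin n) (Fin n) ℂ).submatrix (Equiv.refl _) σ = 1 := by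
      simpa [Function.comp_def] using hconj fun _ ↦ 1
    refine Quot.sound (conjRel_of_mul_eq_one hn h1 (mul_eq_one_comm.1 h1) fun i ↦ ?_)
    have hσ' : ∀ i, x.1 (σ i) = y.1 i := hσ
    fin_cases i
    · refine (hconj _).trans ?_
      simp [diagPair, ← hσ', Function.comp_def]
    · refine (hconj _).trans ?_
      simp [diagPair, ← hσ', Function.comp_def]

lemma diagClass_surjective (hn : 1 ≤ n) : Function.Surjective (diagClass (n := n)) := by
  intro r
  induction r using Quot.ind with | mk s => ?_
  obtain ⟨g, gi, h, h', a, ha⟩ := exists_simultaneous_diagonalization s.2.2 s.2.1.2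
  have hdet : ∀ i, ∏ j, a i j = 1 := fun i ↦ by
    have hg : g.det * gi.det = 1 := by rw [← Matrix.det_mul, h, Matrix.det_one]
    rw [← Matrix.det_diagonal, ← ha, Matrix.det_mul, Matrix.det_mul,
      show (s.1 i).det = 1 from s.2.1.1 i, mul_one, hg]
  refine ⟨⟨fun j ↦ (a 0 j, a 1 j), hdet 0, hdet 1⟩, Eq.symm (Quot.sound
    (conjRel_of_mul_eq_one hn h h' fun i ↦ (ha i).trans ?_))⟩
  fin_cases i <;> rfl

/-- The sum of the norms of the entries of a pair of matrices. -/
noncomputable def entrySum (s : Fin 2 → Matrix (Fin n) (Fin n) ℂ) : ℝ := ∑ i, ∑ k, ∑ j, ‖s i k j‖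

lemma continuous_entrySum : Continuous (entrySum (n := n)) := by
  unfold entrySum
  fun_prop

lemma norm_le_of_det_eq_zero {A : Matrix (Fin n) (Fin n) ℂ} {z : ℂ}
    (h : (z • (1 : Matrix (Fin n) (Fin n) ℂ) - A).det = 0) : ‖z‖ ≤ ∑ k, ∑ j, ‖A k j‖ := by
  obtain ⟨v, hv0, hv⟩ := Matrix.exists_mulVec_eq_zero_iff.2 h
  have hv : Module.End.HasEigenvector (Matrix.toLin' A) z v := by
    refine ⟨Module.End.mem_eigenspace_iff.2 ?_, hv0⟩
    rw [Matrix.sub_mulVec, Matrix.smul_mulVec, Matrix.one_mulVec, sub_eq_zero] at hv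
    exact hv.symm
  obtain ⟨k, hk⟩ := eigenvalue_mem_ball (Module.End.hasEigenvalue_of_hasEigenvector hv)
  rw [mem_closedBall_iff_norm] at hk
  calc ‖z‖ = ‖(z - A k k) + A k k‖ := by rw [sub_add_cancel]
    _ ≤ ‖z - A k k‖ + ‖A k k‖ := norm_add_le _ _
    _ ≤ ∑ j ∈ Finset.univ.erase k, ‖A k j‖ + ‖A k k‖ := by gcongr
    _ = ∑ j, ‖A k j‖ := Finset.sum_erase_add _ _ (Finset.mem_univ k)
    _ ≤ _ := Finset.single_le_sum (f := fun k ↦ ∑ j, ‖A k j‖)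
      (fun _ _ ↦ Finset.sum_nonneg fun _ _ ↦ norm_nonneg _) (Finset.mem_univ k)

lemma norm_le_entrySum {x : detOnePairs n} {s : ssTuples 2 (SLset n)}
    (h : diagClass x = Quot.mk _ s) : ‖x.1‖ ≤ 2 * entrySum s.1 := by
  have hp (l : ℂ) (i : Fin n) : pencil s.1 l ((x.1 i).1 + l * (x.1 i).2) = 0 := by
    rw [← pencil_eq_of_quot_mk_eq h]
    exact (pencil_diagonal x.1 _ _).trans (Finset.prod_eq_zero (Finset.mem_univ i) (sub_self _))
  have hs : entrySum s.1 = ∑ k, ∑ j, ‖s.1 0 k j‖ + ∑ k, ∑ j, ‖s.1 1 k j‖ := by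
    rw [entrySum, Fin.sum_univ_two]
  have h0 : 0 ≤ ∑ k, ∑ j, ‖s.1 0 k j‖ := by positivity
  have h1 : 0 ≤ ∑ k, ∑ j, ‖s.1 1 k j‖ := by positivity
  have ha (i : Fin n) : ‖(x.1 i).1‖ ≤ ∑ k, ∑ j, ‖s.1 0 k j‖ := by
    simpa using norm_le_of_det_eq_zero (hp 0 i)
  have hab (i : Fin n) : ‖(x.1 i).1 + (x.1 i).2‖ ≤ entrySum s.1 := by
    have := norm_le_of_det_eq_zero (hp 1 i)
    simp only [one_mul, one_smul] at this
    refine this.trans ?_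
    rw [hs, ← Finset.sum_add_distrib]
    simp_rw [← Finset.sum_add_distrib]
    gcongr
    exact norm_add_le _ _
  refine (pi_norm_le_iff_of_nonneg (by linarith)).2 fun i ↦ (Prod.norm_def _).trans_le
    (max_le (by linarith [ha i]) ?_)
  calc ‖(x.1 i).2‖ = ‖(x.1 i).1 + (x.1 i).2 - (x.1 i).1‖ := by rw [add_sub_cancel_left]
    _ ≤ ‖(x.1 i).1 + (x.1 i).2‖ + ‖(x.1 i).1‖ := norm_sub_le _ _
    _ ≤ _ := by linarith [ha i, hab i]

lemma isClosed_detOnePairs (n : ℕ) : IsClosed (detOnePairs n) :=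
  (isClosed_eq (f := fun x : Fin n → ℂ × ℂ ↦ ∏ i, (x i).1) (by fun_prop) continuous_const).inter
    (isClosed_eq (f := fun x : Fin n → ℂ × ℂ ↦ ∏ i, (x i).2) (by fun_prop) continuous_const)

lemma isQuotientMap_diagClass (hn : 1 ≤ n) : IsQuotientMap (diagClass (n := n)) := by
  refine isQuotientMap_iff_isClosed.2 ⟨diagClass_surjective hn, fun F ↦
    ⟨fun hF ↦ hF.preimage continuous_diagClass, fun hF ↦ ?_⟩⟩
  refine isQuotientMap_quot_mk.isClosed_preimage.1
    (isClosed_iff_ultrafilter.2 fun s U hU hF' ↦ ?_)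
  choose τ hτ using fun s : ssTuples 2 (SLset n) ↦ diagClass_surjective hn (Quot.mk _ s)
  have hK : IsCompact ((↑) ⁻¹' Metric.closedBall (0 : Fin n → ℂ × ℂ) (2 * (entrySum s.1 + 1)) :
      Set (detOnePairs n)) :=
    (isClosed_detOnePairs n).isClosedEmbedding_subtypeVal.isCompact_preimage
      (isCompact_closedBall _ _)
  have hev : ∀ᶠ t : ssTuples 2 (SLset n) in (U : Filter _), entrySum t.1 < entrySum s.1 + 1 :=
    hU ((continuous_entrySum.comp continuous_subtype_val).continuousAt.eventually_lt_const
      (lt_add_one _))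
  obtain ⟨x, -, hx⟩ := hK.ultrafilter_le_nhds' (U.map τ) (hev.mono fun t ht ↦ by
    rw [Set.mem_preimage, mem_closedBall_zero_iff]
    exact (norm_le_entrySum (hτ t)).trans (by gcongr))
  have hxF : diagClass x ∈ F := hF.mem_of_tendsto hx (Filter.mem_of_superset hF' fun t ht ↦ by
    change diagClass (τ t) ∈ F
    rw [hτ]
    exact ht)
  suffices h : diagClass x = Quot.mk _ s by rwa [Set.mem_preimage, ← h]
  rw [← hτ s, diagClass_eq_iff hn]
  refine entries_eq_of_prod_eq fun l z ↦ ?_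
  rw [← pencil_diagonal, ← pencil_diagonal]
  have h1 : Tendsto (fun t ↦ pencil (diagPair (τ t)).1 l z) U (𝓝 (pencil (diagPair x).1 l z)) :=
    (((continuous_pencil l z).comp continuous_subtype_val).comp
      continuous_diagPair).continuousAt.tendsto.comp (show Tendsto τ U (𝓝 x) from hx)
  have h2 : Tendsto (fun t : ssTuples 2 (SLset n) ↦ pencil t.1 l z) U (𝓝 (pencil s.1 l z)) :=
    ((continuous_pencil l z).comp continuous_subtype_val).continuousAt.tendsto.mono_left hU
  have h3 : ∀ t, pencil (diagPair (τ t)).1 l z = pencil t.1 l z := fun t ↦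
    congrFun (congrFun (pencil_eq_of_quot_mk_eq (hτ t)) l) z
  simp_rw [h3] at h1
  exact (tendsto_nhds_unique h1 h2).trans (h3 s).symm

end CharacterVariety

section Retraction

open Topology

variable {n : ℕ}

/-- The radial deformation of the punctured plane onto the unit circle. -/
noncomputable def radial (t : ℝ) (z : ℂ) : ℂ := z / (‖z‖ ^ t : ℝ)

lemma prod_radial {z : Fin n → ℂ} (hz : ∏ i, z i = 1) (t : ℝ) : ∏ i, radial t (z i) = 1 := by
  simp_rw [radial]
  rw [Finset.prod_div_distrib, hz, ← Complex.ofReal_prod,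
    Real.finsetProd_rpow _ _ fun _ _ ↦ norm_nonneg _, ← norm_prod, hz]
  simp

lemma norm_radial_one {z : ℂ} (hz : z ≠ 0) : ‖radial 1 z‖ = 1 := by
  simp [radial, hz]

lemma radial_zero (z : ℂ) : radial 0 z = z := by
  simp [radial]

lemma radial_of_norm_eq_one {z : ℂ} (hz : ‖z‖ = 1) (t : ℝ) : radial t z = z := by
  simp [radial, hz]

lemma continuous_radial {Y : Type*} [TopologicalSpace Y] {f : Y → ℂ} {t : Y → ℝ}
    (hf : Continuous f) (ht : Continuous t) (h0 : ∀ y, f y ≠ 0) :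
    Continuous fun y ↦ radial (t y) (f y) := by
  unfold radial
  refine hf.div (Complex.continuous_ofReal.comp (hf.norm.rpow ht fun y ↦
    Or.inl (norm_ne_zero_iff.2 (h0 y)))) fun y ↦ ?_
  exact Complex.ofReal_ne_zero.2 (Real.rpow_pos_of_pos (norm_pos_iff.2 (h0 y)) _).ne'

lemma ne_zero_of_prod_eq_one {z : Fin n → ℂ} (hz : ∏ i, z i = 1) (i : Fin n) : z i ≠ 0 := fun h ↦
  zero_ne_one ((Finset.prod_eq_zero (Finset.mem_univ i) h).symm.trans hz)

/-- The radial deformation of pairs of diagonal matrices. -/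
noncomputable def radialPair (t : ℝ) (x : detOnePairs n) : detOnePairs n :=
  ⟨fun i ↦ (radial t (x.1 i).1, radial t (x.1 i).2), prod_radial x.2.1 t, prod_radial x.2.2 t⟩

lemma continuous_radialPair {Y : Type*} [TopologicalSpace Y] {f : Y → detOnePairs n} {t : Y → ℝ}
    (hf : Continuous f) (ht : Continuous t) : Continuous fun y ↦ radialPair (t y) (f y) := by
  have h (i : Fin n) : Continuous fun y ↦ (f y).1 i :=
    (continuous_apply i).comp (continuous_subtype_val.comp hf)
  exact Continuous.subtype_mk (continuous_pi fun i ↦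
    (continuous_radial (h i).fst ht fun y ↦ ne_zero_of_prod_eq_one (f y).2.1 i).prodMk
    (continuous_radial (h i).snd ht fun y ↦ ne_zero_of_prod_eq_one (f y).2.2 i)) _

lemma entries_radialPair (t : ℝ) (x : detOnePairs n) : entries (radialPair t x).1 =
    (entries x.1).map fun a ↦ (radial t a.1, radial t a.2) := by
  rw [map_entries, radialPair]

/-- The retraction of pairs of diagonal matrices to pairs of unitary diagonal matrices. -/
noncomputable def unitarize (x : detOnePairs n) : unitPairs n :=
  ⟨(radialPair 1 x).1, (radialPair 1 x).2, fun i ↦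
    ⟨norm_radial_one (ne_zero_of_prod_eq_one x.2.1 i),
      norm_radial_one (ne_zero_of_prod_eq_one x.2.2 i)⟩⟩

/-- The inclusion of the unitary pairs. -/
def ofUnitPairs (x : unitPairs n) : detOnePairs n := ⟨x.1, x.2.1⟩

lemma unitarize_ofUnitPairs (x : unitPairs n) : unitarize (ofUnitPairs x) = x :=
  Subtype.ext (funext fun i ↦ Prod.ext (radial_of_norm_eq_one (x.2.2 i).1 1)
    (radial_of_norm_eq_one (x.2.2 i).2 1))

end Retraction

/-- Example 4.5(1) of Biswas–Florentino for `G = SL(n,ℂ)`: the space of conjugation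
classes of pairs of commuting semisimple elements of `SL(n,ℂ)` is homotopy equivalent
to `ℂP^{n-1}`, the projectivization of `ℂ^n`. -/
theorem specialLinear_pairs_char_variety_homotopyEquiv_CP (n : ℕ) (hn : 1 ≤ n) :
    Nonempty
      (ContinuousMap.HomotopyEquiv
        (RepSpace (SLset n) (ssTuples 2 (SLset n)))
        (Projectivization ℂ (Fin n → ℂ))) := by
  obtain ⟨Φ, hΦ, hΦiff⟩ := exists_isQuotientMap_unitPairs hn
  have hd := isQuotientMap_diagClass hn
  choose σ hσ using hd.surjective
  choose ρ hρ using hΦ.surjective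
  let p : RepSpace (SLset n) (ssTuples 2 (SLset n)) → Projectivization ℂ (Fin n → ℂ) :=
    fun r ↦ Φ (unitarize (σ r))
  have hp (x : detOnePairs n) : p (diagClass x) = Φ (unitarize x) := by
    have h := (diagClass_eq_iff hn).1 (hσ (diagClass x))
    exact (hΦiff _ _).2 ((entries_radialPair 1 _).trans
      ((congrArg _ h).trans (entries_radialPair 1 x).symm))
  have hpc : Continuous p := by
    rw [hd.continuous_iff]
    refine Continuous.congr (hΦ.continuous.comp ?_) fun x ↦ (hp x).symm
    exact Continuous.subtype_mk (continuous_subtype_val.comp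
      (continuous_radialPair continuous_id continuous_const)) _
  let q : Projectivization ℂ (Fin n → ℂ) → RepSpace (SLset n) (ssTuples 2 (SLset n)) :=
    fun P ↦ diagClass (ofUnitPairs (ρ P))
  have hq (x : unitPairs n) : q (Φ x) = diagClass (ofUnitPairs x) :=
    (diagClass_eq_iff hn).2 ((hΦiff _ _).1 (hρ (Φ x)))
  have hqc : Continuous q := by
    rw [hΦ.continuous_iff]
    refine Continuous.congr (continuous_diagClass.comp ?_) fun x ↦ (hq x).symm
    exact Continuous.subtype_mk continuous_subtype_val _
  let H : RepSpace (SLset n) (ssTuples 2 (SLset n)) × unitInterval →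
      RepSpace (SLset n) (ssTuples 2 (SLset n)) := fun r ↦ diagClass (radialPair r.2 (σ r.1))
  have hH (x : detOnePairs n) (t : unitInterval) :
      H (diagClass x, t) = diagClass (radialPair t x) := by
    have h := (diagClass_eq_iff hn).1 (hσ (diagClass x))
    exact (diagClass_eq_iff hn).2 ((entries_radialPair t _).trans
      ((congrArg _ h).trans (entries_radialPair t x).symm))
  have hHc : Continuous H := by
    refine hd.continuous_lift_prod_left ?_
    simp_rw [hH]
    exact continuous_diagClass.comp
      (continuous_radialPair continuous_fst (continuous_subtype_val.comp continuous_snd))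
  have hqp : (ContinuousMap.id _).Homotopic ((⟨q, hqc⟩ : C(_, _)).comp ⟨p, hpc⟩) := by
    refine ⟨⟨⟨fun r ↦ H (r.2, r.1), hHc.comp continuous_swap⟩, fun r ↦ ?_, fun r ↦ ?_⟩⟩
    · obtain ⟨x, rfl⟩ := hd.surjective r
      refine (hH x 0).trans (congrArg diagClass (Subtype.ext (funext fun i ↦ ?_)))
      exact Prod.ext (radial_zero _) (radial_zero _)
    · obtain ⟨x, rfl⟩ := hd.surjective r
      exact (hH x 1).trans (((hq (unitarize x)).symm).trans (congrArg q (hp x).symm))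
  have hpq : (⟨p, hpc⟩ : C(_, _)).comp ⟨q, hqc⟩ = ContinuousMap.id _ := by
    ext1 P
    obtain ⟨x, rfl⟩ := hΦ.surjective P
    change p (q (Φ x)) = Φ x
    rw [hq, hp, unitarize_ofUnitPairs]
  exact ⟨⟨⟨p, hpc⟩, ⟨q, hqc⟩, hqp.symm, hpq ▸ ContinuousMap.Homotopic.refl _⟩⟩
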